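/- arXiv:1203.3306 — 2 statements merged into one kernel-verified Lean document; each statement's English description precedes it below -/
import Mathlib

section
/- Let P be the transition kernel of the simple random walk on the half-plane one-way lattice ℍ, and G its Green function. Then for every x ∈ ℤ², the Martin kernel K(x,y) = G(x,y)/G((0,0),y) tends to 1 as |y₁| + |y₂| → ∞ along y = (y₁,y₂) ∈ ℤ². Consequently the Martin boundary of the simple random walk on ℍ is trivial (reduces to one point). -/
open Filter

noncomputable section

/-- Transition kernel of the simple random walk on the half-plane one-way lattice ℍ:
from `(x,y)` with `y ≠ 0` the walk moves to `(x,y+1)`, `(x,y-1)` and `(x + sgn y, y)`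
with probability `1/3` each; from `(x,0)` it moves to `(x,1)` and `(x,-1)` with
probability `1/2` each. -/
def halfPlaneKernel : ℤ × ℤ → ℤ × ℤ → ℝ := fun u v =>
  if u.2 ≠ 0 then
    (if v = (u.1, u.2 + 1) then (1 : ℝ) / 3 else 0) +
    (if v = (u.1, u.2 - 1) then (1 : ℝ) / 3 else 0) +
    (if v = (u.1 + Int.sign u.2, u.2) then (1 : ℝ) / 3 else 0)
  else
    (if v = (u.1, 1) then (1 : ℝ) / 2 else 0) +
    (if v = (u.1, -1) then (1 : ℝ) / 2 else 0)

/-- Powers of the transition kernel: `P⁰(u,v) = δ_{u,v}`,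
`P^{n+1}(u,v) = ∑_w P^n(u,w) P(w,v)`. -/
def kernelPow : ℕ → ℤ × ℤ → ℤ × ℤ → ℝ
  | 0, u, v => if u = v then 1 else 0
  | n + 1, u, v => ∑' w : ℤ × ℤ, kernelPow n u w * halfPlaneKernel w v

/-- Green function `G(u,v) = ∑_{n ≥ 0} P^n(u,v)`. -/
def greenFn (u v : ℤ × ℤ) : ℝ := ∑' n : ℕ, kernelPow n u v

/-- The transition operator acting on functions. -/
def PP (f : ℤ × ℤ → ℝ) (u : ℤ × ℤ) : ℝ :=
  if u.2 ≠ 0 then (f (u.1, u.2 + 1) + f (u.1, u.2 - 1) + f (u.1 + Int.sign u.2, u.2)) / 3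
  else (f (u.1, 1) + f (u.1, -1)) / 2

lemma PP_pos (f : ℤ × ℤ → ℝ) (x y : ℤ) (hy : 0 < y) :
    PP f (x, y) = (f (x, y + 1) + f (x, y - 1) + f (x + 1, y)) / 3 := by
  simp [PP, hy.ne', Int.sign_eq_one_of_pos hy]

lemma PP_neg (f : ℤ × ℤ → ℝ) (x y : ℤ) (hy : y < 0) :
    PP f (x, y) = (f (x, y + 1) + f (x, y - 1) + f (x - 1, y)) / 3 := by
  simp [PP, hy.ne, Int.sign_eq_neg_one_of_neg hy, sub_eq_add_neg]

lemma PP_zero (f : ℤ × ℤ → ℝ) (x : ℤ) :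
    PP f (x, 0) = (f (x, 1) + f (x, -1)) / 2 := by
  simp [PP]

lemma PP_mono {f g : ℤ × ℤ → ℝ} (h : ∀ u, f u ≤ g u) (u : ℤ × ℤ) : PP f u ≤ PP g u := by
  unfold PP
  split_ifs
  · linarith [h (u.1, u.2 + 1), h (u.1, u.2 - 1), h (u.1 + Int.sign u.2, u.2)]
  · linarith [h (u.1, 1), h (u.1, -1)]

lemma PP_comb (a b : ℝ) (f g : ℤ × ℤ → ℝ) (u : ℤ × ℤ) :
    PP (fun v => a * f v + b * g v) u = a * PP f u + b * PP g u := by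
  unfold PP
  split_ifs <;> ring

lemma PP_const (a : ℝ) (u : ℤ × ℤ) : PP (fun _ => a) u = a := by
  unfold PP
  split_ifs <;> ring

/-- Horizontal translation. -/
def tr (k : ℤ) (f : ℤ × ℤ → ℝ) : ℤ × ℤ → ℝ := fun u => f (u.1 + k, u.2)

/-- Point reflection. -/
def rf (f : ℤ × ℤ → ℝ) : ℤ × ℤ → ℝ := fun u => f (-u.1, -u.2)

lemma PP_tr (k : ℤ) (f : ℤ × ℤ → ℝ) (u : ℤ × ℤ) : PP (tr k f) u = PP f (u.1 + k, u.2) := by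
  unfold PP tr
  split_ifs
  · simp only [add_right_comm]
  · simp

lemma PP_rf (f : ℤ × ℤ → ℝ) (u : ℤ × ℤ) : PP (rf f) u = PP f (-u.1, -u.2) := by
  obtain ⟨x, y⟩ := u
  rcases lt_trichotomy y 0 with h | h | h
  · rw [PP_neg _ _ _ h]
    simp only
    rw [PP_pos _ _ _ (by omega)]
    simp only [rf]
    rw [show -(y + 1) = -y - 1 by ring, show -(y - 1) = -y + 1 by ring,
      show -(x - 1) = -x + 1 by ring]
    ring
  · subst h
    simp only [neg_zero]
    rw [PP_zero, PP_zero]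
    simp only [rf, neg_neg]
    ring
  · rw [PP_pos _ _ _ h]
    simp only
    rw [PP_neg _ _ _ (by omega)]
    simp only [rf]
    rw [show -(y + 1) = -y - 1 by ring, show -(y - 1) = -y + 1 by ring,
      show -(x + 1) = -x - 1 by ring]
    ring

lemma concave_drop (φ : ℕ → ℝ) (n : ℕ) (δ : ℝ)
    (hc : ∀ j, j + 1 < n → φ (j + 2) + φ j ≤ 2 * φ (j + 1)) (h0 : φ 1 ≤ φ 0 - δ) :
    φ n ≤ φ 0 - n * δ := by
  have key : ∀ j, j < n → φ (j + 1) ≤ φ j - δ := by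
    intro j
    induction j with
    | zero => intro _; exact h0
    | succ j ih =>
      intro hj
      have := ih (by omega)
      have := hc j hj
      show φ (j + 2) ≤ _
      linarith
  have key2 : ∀ j : ℕ, j ≤ n → φ j ≤ φ 0 - j * δ := by
    intro j
    induction j with
    | zero => intro _; simp
    | succ j ih =>
      intro hj
      have h1 := ih (by omega)
      have h2 := key j (by omega)
      push_cast
      linarith
  exact key2 n le_rfl

lemma tent (φ : ℤ → ℝ) (n : ℕ) (ε : ℝ) (hε : 0 < ε) (hpos : ∀ j, 0 ≤ φ j) (h0 : 0 < φ 0)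
    (h : ∀ j : ℤ, |j| < n → φ (j + 1) + φ (j - 1) ≤ (2 - ε) * φ j) : n * ε ≤ 2 := by
  rcases Nat.eq_zero_or_pos n with hn | hn
  · subst hn; simp
  have h1 := h 0 (by simpa using hn)
  have fin : ∀ ψ : ℕ → ℝ, ψ 0 = φ 0 → (∀ j, 0 ≤ ψ j) → ψ 1 ≤ φ 0 - ε / 2 * φ 0 →
      (∀ j, j + 1 < n → ψ (j + 2) + ψ j ≤ 2 * ψ (j + 1)) → n * ε ≤ 2 := by
    intro ψ e0 e1 e2 e3
    have := concave_drop ψ n (ε / 2 * φ 0) e3 (by rw [e0]; exact e2)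
    have h5 := e1 n
    rw [e0] at this
    have : 0 ≤ φ 0 * (1 - n * ε / 2) := by nlinarith
    have := nonneg_of_mul_nonneg_right this h0
    linarith
  simp only [zero_add, zero_sub] at h1
  rcases le_or_gt (φ 1) (φ 0 - ε / 2 * φ 0) with hh | hh
  · refine fin (fun j => φ j) (by simp) (fun j => hpos _) (by simpa using hh) ?_
    intro j hj
    have := h (j + 1) (by rw [abs_of_nonneg (by positivity)]; exact_mod_cast hj)
    have h3 := hpos (j + 1)
    push_cast
    rw [show (j : ℤ) + 1 + 1 = j + 2 by ring, show (j : ℤ) + 1 - 1 = j by ring] at this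
    nlinarith
  · refine fin (fun j => φ (-j)) (by simp) (fun j => hpos _) ?_ ?_
    · simp only [Nat.cast_one]; linarith
    intro j hj
    have := h (-(j + 1)) (by rw [abs_neg, abs_of_nonneg (by positivity)]; exact_mod_cast hj)
    have h3 := hpos (-(j + 1))
    push_cast
    rw [show -((j : ℤ) + 1) + 1 = -j by ring, show -((j : ℤ) + 1) - 1 = -(j + 2) by ring] at this
    nlinarith

/-- Nonnegative, harmonic on the open upper half plane, and zero below. -/
structure IsW (w : ℤ × ℤ → ℝ) : Prop where
  nonneg : ∀ u, 0 ≤ w u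
  zero : ∀ k b : ℤ, b ≤ 0 → w (k, b) = 0
  harm : ∀ k b : ℤ, 0 < b → 3 * w (k, b) = w (k, b + 1) + w (k, b - 1) + w (k + 1, b)

lemma IsW.improve (M : ℝ) (hM1 : 1 < M)
    (hM : ∀ w, IsW w → ∀ k b : ℤ, w (k + 1, b) ≤ M * w (k, b)) :
    ∃ δ > 0, ∀ w, IsW w → ∀ k b : ℤ, w (k + 1, b) ≤ (M - δ) * w (k, b) := by
  obtain ⟨n, hn⟩ := exists_nat_gt (2 / ((M - 1) / 2))
  rw [div_lt_iff₀ (by linarith)] at hn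
  refine ⟨(M - 1) / 2 / 9 ^ (2 * n), by have : 0 < M - 1 := by linarith
                                        positivity, ?_⟩
  set δ := (M - 1) / 2 / 9 ^ (2 * n) with hδ
  have hδ0 : 0 < δ := by
    have : 0 < M - 1 := by linarith
    positivity
  intro w hw k b
  by_contra! hcon
  have hb : 0 < b := by
    by_contra! hb
    rw [hw.zero _ _ hb, hw.zero _ _ hb] at hcon
    simp at hcon
  have g0 := hM w hw
  have claim : ∀ i : ℕ, M * w (k, b + i) - w (k + 1, b + i) ≤ 9 ^ i * δ * w (k, b + i) := by
    intro i
    induction i with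
    | zero => simp; linarith
    | succ i ih =>
      have e1 := hw.harm k (b + i) (by omega)
      have e2 := hw.harm (k + 1) (b + i) (by omega)
      have e3 := hw.harm k (b + i + 1) (by omega)
      rw [show b + (i : ℤ) + 1 - 1 = b + i by ring] at e3
      have a1 := g0 k (b + i - 1)
      have a2 := g0 (k + 1) (b + i)
      have a3 := hw.nonneg (k, b + i + 1 + 1)
      have a4 := hw.nonneg (k + 1, b + i + 1)
      push_cast
      rw [← add_assoc, pow_succ]
      have : 9 ^ i * δ * w (k, b + i) ≤ 9 ^ i * δ * (3 * w (k, b + i + 1)) := by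
        apply mul_le_mul_of_nonneg_left _ (by positivity)
        linarith
      have e1' : M * (3 * w (k, b + i)) =
          M * w (k, b + i + 1) + M * w (k, b + i - 1) + M * w (k + 1, b + i) := by rw [e1]; ring
      linarith
  have posi : ∀ i : ℕ, 0 < w (k, b + i) := by
    intro i
    induction i with
    | zero =>
      simp only [Nat.cast_zero, add_zero]
      rcases (hw.nonneg (k, b)).lt_or_eq with h | h
      · exact h
      · have := g0 k b
        rw [← h] at this hcon
        linarith
    | succ i ih =>
      have e3 := hw.harm k (b + i + 1) (by omega)
      rw [show b + (i : ℤ) + 1 - 1 = b + i by ring] at e3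
      have a3 := hw.nonneg (k, b + i + 1 + 1)
      have a4 := hw.nonneg (k + 1, b + i + 1)
      push_cast
      rw [← add_assoc]
      linarith
  have := tent (fun j => w (k, b + n + j)) n ((M - 1) / 2) (by linarith) (fun j => hw.nonneg _)
    (by simpa using posi n) ?_
  · linarith
  · intro j hj
    rw [abs_lt] at hj
    have e := hw.harm k (b + n + j) (by omega)
    have c := claim (n + j).toNat
    have : ((n + j).toNat : ℤ) = n + j := Int.toNat_of_nonneg (by omega)
    rw [this, ← add_assoc] at c
    have p : (9 : ℝ) ^ (n + j).toNat * δ ≤ (M - 1) / 2 := by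
      rw [hδ, mul_div_assoc', div_le_iff₀ (by positivity), mul_comm]
      apply mul_le_mul_of_nonneg_left _ (by linarith)
      exact pow_le_pow_right₀ (by norm_num) (by omega)
    have q := mul_le_mul_of_nonneg_right p (hw.nonneg (k, b + n + j))
    rw [← add_assoc, show b + n + (j - 1) = b + n + j - 1 by ring]
    linarith

lemma IsW.mono : ∀ w, IsW w → ∀ k b : ℤ, w (k + 1, b) ≤ w (k, b) := by
  let S : Set ℝ := {M | 1 ≤ M ∧ ∀ w, IsW w → ∀ k b : ℤ, w (k + 1, b) ≤ M * w (k, b)}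
  have h3 : (3 : ℝ) ∈ S := by
    refine ⟨by norm_num, fun w hw k b => ?_⟩
    rcases le_or_gt b 0 with hb | hb
    · simp [hw.zero _ _ hb]
    · have := hw.harm k b hb
      linarith [hw.nonneg (k, b + 1), hw.nonneg (k, b - 1)]
  have hbd : BddBelow S := ⟨1, fun M hM => hM.1⟩
  have hcl : sInf S ∈ S := by
    have : IsClosed S := by
      have : S = Set.Ici 1 ∩ ⋂ (w) (_ : IsW w) (k : ℤ) (b : ℤ),
          {M : ℝ | w (k + 1, b) ≤ M * w (k, b)} := by
        ext M; simp [S]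
      rw [this]
      refine isClosed_Ici.inter ?_
      refine isClosed_iInter fun w => isClosed_iInter fun _ => isClosed_iInter fun k =>
        isClosed_iInter fun b => ?_
      exact isClosed_le (by fun_prop) (by fun_prop)
    exact this.csInf_mem ⟨3, h3⟩ hbd
  have h1 : sInf S = 1 := by
    refine le_antisymm ?_ hcl.1
    by_contra! hlt
    obtain ⟨δ, hδ, hd⟩ := IsW.improve _ hlt hcl.2
    have hmem : max 1 (sInf S - δ) ∈ S := by
      refine ⟨le_max_left _ _, fun w hw k b => (hd w hw k b).trans ?_⟩
      exact mul_le_mul_of_nonneg_right (le_max_right _ _) (hw.nonneg _)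
    have := csInf_le hbd hmem
    rcases le_max_iff.1 this with h | h <;> linarith
  have := hcl.2
  rw [h1] at this
  simpa using this
lemma PP_tendsto {ι : Type*} {l : Filter ι} {F : ι → ℤ × ℤ → ℝ} {f : ℤ × ℤ → ℝ}
    (h : ∀ u, Tendsto (fun n => F n u) l (nhds (f u))) (u : ℤ × ℤ) :
    Tendsto (fun n => PP (F n) u) l (nhds (PP f u)) := by
  unfold PP
  split_ifs
  · exact (((h _).add (h _)).add (h _)).div_const _
  · exact ((h _).add (h _)).div_const _

/-- Counting visits to the axis. -/
def Vn : ℕ → ℤ × ℤ → ℝ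
  | 0, _ => 0
  | n + 1, u => PP (Vn n) u + if u.2 = 0 then 1 else 0

lemma linear_nonneg (l : ℕ → ℝ) (hl : ∀ n, 0 ≤ l n) (h : ∀ n, l (n + 2) + l n = 2 * l (n + 1)) :
    l 0 ≤ l 1 := by
  by_contra! hlt
  obtain ⟨n, hn⟩ := exists_nat_gt (l 0 / (l 0 - l 1))
  rw [div_lt_iff₀ (by linarith)] at hn
  have := concave_drop l n (l 0 - l 1) (fun j _ => (h j).le) (by linarith)
  linarith [hl n]

lemma no_recur (s : ℤ × ℤ → ℝ) (c : ℝ) (hc : 0 < c) (hs : ∀ u, 0 ≤ s u)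
    (h : ∀ u, PP s u + (if u.2 = 0 then c else 0) ≤ s u) : False := by
  have hle : ∀ n u, c * Vn n u ≤ s u := by
    intro n
    induction n with
    | zero => intro u; simpa [Vn] using hs u
    | succ n ih =>
      intro u
      refine le_trans ?_ (h u)
      have h1 := PP_mono ih u
      have h2 := PP_comb c 0 (Vn n) (fun _ => 0) u
      simp only [zero_mul, add_zero, mul_zero] at h2
      rw [h2] at h1
      simp only [Vn]
      split_ifs <;> linarith
  have hm : ∀ n u, Vn n u ≤ Vn (n + 1) u := by
    intro n
    induction n with
    | zero =>
      intro u
      have := PP_const 0 u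
      simp only [Vn]
      change 0 ≤ PP (fun _ => 0) u + _
      rw [this]
      split_ifs <;> norm_num
    | succ n ih =>
      intro u
      have := PP_mono ih u
      rw [Vn, Vn]
      linarith
  have hnn : ∀ n u, 0 ≤ Vn n u := by
    intro n u
    have : Monotone (fun n => Vn n u) := monotone_nat_of_le_succ (fun n => hm n u)
    exact this (Nat.zero_le n)
  have hind : ∀ n (x b : ℤ), Vn n (x, b) = Vn n (0, b) := by
    intro n
    induction n with
    | zero => intro x b; rfl
    | succ n ih =>
      intro x b
      simp only [Vn, PP]
      rw [ih x, ih x, ih (x + _), ih (0 + _), ih x, ih x]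
  have hlim : ∀ u, ∃ l, Tendsto (fun n => Vn n u) atTop (nhds l) := by
    intro u
    refine ⟨_, tendsto_atTop_ciSup (monotone_nat_of_le_succ (fun n => hm n u)) ⟨s u / c, ?_⟩⟩
    rintro _ ⟨n, rfl⟩
    rw [le_div_iff₀ hc, mul_comm]
    exact hle n u
  choose L hL using hlim
  have hLnn : ∀ u, 0 ≤ L u := fun u => ge_of_tendsto' (hL u) (fun n => hnn n u)
  have hLind : ∀ x b : ℤ, L (x, b) = L (0, b) := by
    intro x b
    refine tendsto_nhds_unique (hL (x, b)) ?_
    simp only [hind _ x b]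
    exact hL _
  have hLeq : ∀ u, L u = PP L u + if u.2 = 0 then 1 else 0 := by
    intro u
    refine tendsto_nhds_unique ((tendsto_add_atTop_iff_nat 1).2 (hL u)) ?_
    simp only [Vn]
    exact (PP_tendsto hL u).add_const _
  have hL0 := hLeq (0, 0)
  rw [PP_zero] at hL0
  simp only [if_true] at hL0
  have h1 := linear_nonneg (fun n => L (0, n)) (fun n => hLnn _) (by
    intro n
    have := hLeq (0, (n : ℤ) + 1)
    rw [PP_pos _ _ _ (by omega), if_neg (by simp only; omega), hLind (0 + 1)] at this
    rw [show (n : ℤ) + 1 - 1 = n by ring, show (n : ℤ) + 1 + 1 = n + 2 by ring] at this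
    push_cast
    linarith)
  have h2 := linear_nonneg (fun n => L (0, -n)) (fun n => hLnn _) (by
    intro n
    have := hLeq (0, -((n : ℤ) + 1))
    rw [PP_neg _ _ _ (by omega), if_neg (by simp only; omega), hLind (0 - 1)] at this
    rw [show -((n : ℤ) + 1) - 1 = -(n + 2) by ring, show -((n : ℤ) + 1) + 1 = -n by ring] at this
    push_cast
    linarith)
  simp at h1 h2
  linarith

/-- Nonnegative harmonic functions. -/
structure IsH (h : ℤ × ℤ → ℝ) : Prop where
  nonneg : ∀ u, 0 ≤ h u
  harm : ∀ u, PP h u = h u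

lemma IsH.tr {h : ℤ × ℤ → ℝ} (hh : IsH h) (k : ℤ) : IsH (tr k h) :=
  ⟨fun u => hh.nonneg _, fun u => by rw [PP_tr, hh.harm]; rfl⟩

lemma IsH.rf {h : ℤ × ℤ → ℝ} (hh : IsH h) : IsH (rf h) :=
  ⟨fun u => hh.nonneg _, fun u => by rw [PP_rf, hh.harm]; rfl⟩

/-- Iterates of the operator killed outside the open upper half plane. -/
def wn (h : ℤ × ℤ → ℝ) : ℕ → ℤ × ℤ → ℝ
  | 0, u => if 0 < u.2 then h u else 0
  | n + 1, u => if 0 < u.2 then PP (wn h n) u else 0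

lemma PP_nonneg {f : ℤ × ℤ → ℝ} (h : ∀ u, 0 ≤ f u) (u : ℤ × ℤ) : 0 ≤ PP f u := by
  rw [← PP_const 0 u]
  exact PP_mono h u

lemma wn_nonneg {h : ℤ × ℤ → ℝ} (hh : IsH h) (n : ℕ) : ∀ u, 0 ≤ wn h n u := by
  induction n with
  | zero => intro u; simp only [wn]; split_ifs; exacts [hh.nonneg u, le_rfl]
  | succ n ih => intro u; simp only [wn]; split_ifs; exacts [PP_nonneg ih u, le_rfl]

lemma wn_anti {h : ℤ × ℤ → ℝ} (hh : IsH h) (n : ℕ) : ∀ u, wn h (n + 1) u ≤ wn h n u := by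
  induction n with
  | zero =>
    intro u
    simp only [wn]
    split_ifs
    · rw [← hh.harm u]
      apply PP_mono
      intro v
      split_ifs
      exacts [le_rfl, hh.nonneg v]
    · exact le_rfl
  | succ n ih =>
    intro u
    rw [wn, wn]
    split_ifs
    exacts [PP_mono ih u, le_rfl]

lemma wn_tendsto {h : ℤ × ℤ → ℝ} (hh : IsH h) (u : ℤ × ℤ) :
    Tendsto (fun n => wn h n u) atTop (nhds 0) := by
  have hlim : ∀ u, ∃ l, Tendsto (fun n => wn h n u) atTop (nhds l) := by
    intro u
    refine ⟨_, tendsto_atTop_ciInf (antitone_nat_of_succ_le (fun n => wn_anti hh n u)) ⟨0, ?_⟩⟩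
    rintro _ ⟨n, rfl⟩
    exact wn_nonneg hh n u
  choose w hw using hlim
  have hnn : ∀ u, 0 ≤ w u := fun u => ge_of_tendsto' (hw u) (fun n => wn_nonneg hh n u)
  have hle : ∀ u, w u ≤ h u := by
    intro u
    refine le_of_tendsto' (hw u) (fun n => ?_)
    have : Antitone (fun n => wn h n u) := antitone_nat_of_succ_le (fun n => wn_anti hh n u)
    refine (this (Nat.zero_le n)).trans ?_
    simp only [wn]
    split_ifs
    exacts [le_rfl, hh.nonneg u]
  have hz : ∀ u : ℤ × ℤ, ¬ 0 < u.2 → w u = 0 := by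
    intro u hu
    refine tendsto_nhds_unique (hw u) ?_
    have : (fun n => wn h n u) = fun _ => 0 := by
      funext n
      cases n <;> simp only [wn, if_neg hu]
    rw [this]
    exact tendsto_const_nhds
  have hp : ∀ u : ℤ × ℤ, 0 < u.2 → w u = PP w u := by
    intro u hu
    refine tendsto_nhds_unique ((tendsto_add_atTop_iff_nat 1).2 (hw u)) ?_
    simp only [wn, if_pos hu]
    exact PP_tendsto hw u
  have hW : IsW w := by
    refine ⟨hnn, fun k b hb => hz _ (by simpa using hb), fun k b hb => ?_⟩
    rw [hp (k, b) hb, PP_pos _ _ _ hb]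
    ring
  have hmono := IsW.mono w hW
  have hone : ∀ k : ℤ, w (k, 1) = 0 := by
    intro k
    by_contra hne
    have ha : 0 < w (k, 1) := lt_of_le_of_ne (hnn _) (Ne.symm hne)
    have hm2 : ∀ j : ℕ, w (k, 1) ≤ w (k - j, 1) := by
      intro j
      induction j with
      | zero => simp
      | succ j ih =>
        refine ih.trans ?_
        have := hmono (k - (j + 1)) 1
        rw [show k - ((j : ℤ) + 1) + 1 = k - j by ring] at this
        push_cast
        exact this
    have hm3 : ∀ i : ℤ, i ≤ k → w (k, 1) ≤ w (i, 1) := by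
      intro i hi
      have := hm2 (k - i).toNat
      rwa [Int.toNat_of_nonneg (by omega), show k - (k - i) = i by ring] at this
    -- the superharmonic function h - w, translated to k
    let σ : ℤ × ℤ → ℝ := tr k (fun u => 1 * h u + (-1) * w u)
    have σnn : ∀ u, 0 ≤ σ u := fun u => by
      simp only [σ, tr]
      linarith [hle (u.1 + k, u.2)]
    have σs : ∀ u : ℤ × ℤ, PP σ u + (if u.2 = 0 ∧ u.1 ≤ 0 then w (k, 1) / 2 else 0) ≤ σ u := by
      intro u
      have e1 : PP σ u = h (u.1 + k, u.2) - PP w (u.1 + k, u.2) := by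
        simp only [σ]
        rw [PP_tr, PP_comb, hh.harm]
        ring
      have e2 : σ u = h (u.1 + k, u.2) - w (u.1 + k, u.2) := by
        simp only [σ, tr]
        ring
      rw [e1, e2]
      split_ifs with hc
      · rw [hc.1, PP_zero]
        have := hm3 (u.1 + k) (by omega)
        have := hnn (u.1 + k, -1)
        have := hz (u.1 + k, 0) (by simp)
        linarith
      · have : w (u.1 + k, u.2) ≤ PP w (u.1 + k, u.2) := by
          by_cases hu : 0 < u.2
          · rw [← hp _ (by exact hu)]
          · rw [hz _ (by exact hu)]
            exact PP_nonneg hnn _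
        linarith
    refine no_recur (fun u => 1 * σ u + 1 * _root_.rf σ u) (w (k, 1) / 2) (by linarith)
      (fun u => ?_) (fun u => ?_)
    · simp only [_root_.rf]
      linarith [σnn u, σnn (-u.1, -u.2)]
    · rw [PP_comb, PP_rf]
      have h1 := σs u
      have h2 := σs (-u.1, -u.2)
      simp only [_root_.rf]
      simp only at h2
      split_ifs at h1 h2 ⊢ with c1 c2 c3 <;> first | linarith | (exfalso; omega)
  have hall : ∀ b : ℕ, ∀ k : ℤ, w (k, b) = 0 := by
    intro b
    induction b using Nat.strong_induction_on with
    | _ b ih =>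
      intro k
      rcases b with _ | _ | b
      · exact hz _ (by simp)
      · simpa using hone k
      · have := hW.harm k (b + 1) (by omega)
        have a1 := ih (b + 1) (by omega) k
        have a2 := ih (b + 1) (by omega) (k + 1)
        push_cast at a1 a2 ⊢
        have a3 := hnn (k, b + 1 - 1)
        have a4 := hnn (k, b + 1 + 1)
        linarith
  have : w u = 0 := by
    by_cases hu : 0 < u.2
    · have := hall u.2.toNat u.1
      rwa [Int.toNat_of_nonneg hu.le] at this
    · exact hz u hu
  rw [← this]
  exact hw u

lemma max_principle_up {h g : ℤ × ℤ → ℝ} (hh : IsH h) (hg : ∀ u, PP g u = g u)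
    (hgh : ∀ u, -h u ≤ g u) (hax : ∀ k : ℤ, 0 ≤ g (k, 0)) (u : ℤ × ℤ) (hu : 0 ≤ u.2) :
    0 ≤ g u := by
  have key : ∀ n, ∀ u : ℤ × ℤ, 0 ≤ u.2 → - wn h n u ≤ g u := by
    intro n
    induction n with
    | zero =>
      intro u hu
      simp only [wn]
      split_ifs with h0
      · exact hgh u
      · obtain ⟨x, y⟩ := u
        simp only at hu h0
        obtain rfl : y = 0 := by omega
        simpa using hax x
    | succ n ih =>
      intro u hu
      simp only [wn]
      obtain ⟨x, y⟩ := u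
      simp only at hu
      split_ifs with h0
      · simp only at h0
        rw [← hg, PP_pos _ _ _ h0, PP_pos _ _ _ h0]
        have a1 := ih (x, y + 1) (by simp only; omega)
        have a2 := ih (x, y - 1) (by simp only; omega)
        have a3 := ih (x + 1, y) (by simp only; omega)
        linarith
      · simp only at h0
        obtain rfl : y = 0 := by omega
        simpa using hax x
  have := (wn_tendsto hh u).neg
  rw [neg_zero] at this
  exact le_of_tendsto' this (fun n => key n u hu)

lemma max_principle {h g : ℤ × ℤ → ℝ} (hh : IsH h) (hg : ∀ u, PP g u = g u)
    (hgh : ∀ u, -h u ≤ g u) (hax : ∀ k : ℤ, 0 ≤ g (k, 0)) (u : ℤ × ℤ) :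
    0 ≤ g u := by
  rcases le_total 0 u.2 with hu | hu
  · exact max_principle_up hh hg hgh hax u hu
  · have := max_principle_up (g := rf g) hh.rf (fun v => by rw [PP_rf, hg]; rfl)
      (fun v => hgh _) (fun k => by simpa [rf] using hax (-k)) (-u.1, -u.2) (by simpa using hu)
    simpa [rf] using this
/-- Quantitative (Harnack) reachability of `v` from `u`. -/
def Conn (u v : ℤ × ℤ) : Prop :=
  ∃ c : ℝ, 0 < c ∧ ∀ p : ℤ × ℤ → ℝ, (∀ u, 0 ≤ p u) → (∀ u, PP p u ≤ p u) → c * p v ≤ p u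

lemma Conn.refl (u : ℤ × ℤ) : Conn u u := ⟨1, one_pos, fun p _ _ => by simp⟩

lemma Conn.trans {u v w : ℤ × ℤ} (h1 : Conn u v) (h2 : Conn v w) : Conn u w := by
  obtain ⟨c, hc, h1⟩ := h1
  obtain ⟨d, hd, h2⟩ := h2
  refine ⟨c * d, by positivity, fun p hp hs => ?_⟩
  rw [mul_assoc]
  exact (mul_le_mul_of_nonneg_left (h2 p hp hs) hc.le).trans (h1 p hp hs)

lemma Conn.up (x y : ℤ) : Conn (x, y) (x, y + 1) := by
  refine ⟨1 / 3, by norm_num, fun p hp hs => ?_⟩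
  refine le_trans ?_ (hs (x, y))
  unfold PP
  simp only
  split_ifs with h
  · linarith [hp (x, y - 1), hp (x + y.sign, y)]
  · obtain rfl : y = 0 := by omega
    simp only [zero_add]
    linarith [hp (x, 1), hp (x, -1)]

lemma Conn.down (x y : ℤ) : Conn (x, y) (x, y - 1) := by
  refine ⟨1 / 3, by norm_num, fun p hp hs => ?_⟩
  refine le_trans ?_ (hs (x, y))
  unfold PP
  simp only
  split_ifs with h
  · linarith [hp (x, y + 1), hp (x + y.sign, y)]
  · obtain rfl : y = 0 := by omega
    simp only [zero_sub]
    linarith [hp (x, 1), hp (x, -1)]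

lemma Conn.right (x : ℤ) : Conn (x, 0) (x + 1, 0) := by
  have h : Conn (x, 1) (x + 1, 1) := by
    refine ⟨1 / 3, by norm_num, fun p hp hs => ?_⟩
    refine le_trans ?_ (hs (x, 1))
    rw [PP_pos _ _ _ one_pos]
    norm_num
    linarith [hp (x, 2), hp (x, 0)]
  exact ((Conn.up x 0).trans h).trans (Conn.down (x + 1) 1)

lemma Conn.left (x : ℤ) : Conn (x, 0) (x - 1, 0) := by
  have h : Conn (x, -1) (x - 1, -1) := by
    refine ⟨1 / 3, by norm_num, fun p hp hs => ?_⟩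
    refine le_trans ?_ (hs (x, -1))
    rw [PP_neg _ _ _ (by norm_num)]
    norm_num
    linarith [hp (x, -2), hp (x, 0)]
  exact ((Conn.down x 0).trans h).trans (Conn.up (x - 1) (-1))

lemma Conn.vert (x y z : ℤ) : Conn (x, y) (x, z) := by
  induction z using Int.inductionOn' (b := y) with
  | zero => exact Conn.refl _
  | succ k _ ih => exact ih.trans (Conn.up x k)
  | pred k _ ih => exact ih.trans (Conn.down x k)

lemma Conn.horiz (x y : ℤ) : Conn (x, 0) (y, 0) := by
  induction y using Int.inductionOn' (b := x) with
  | zero => exact Conn.refl _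
  | succ k _ ih => exact ih.trans (Conn.right k)
  | pred k _ ih => exact ih.trans (Conn.left k)

lemma Conn.all (u v : ℤ × ℤ) : Conn u v :=
  ((Conn.vert u.1 u.2 0).trans (Conn.horiz u.1 v.1)).trans (Conn.vert v.1 0 v.2)

lemma IsH.pos {h : ℤ × ℤ → ℝ} (hh : IsH h) {u : ℤ × ℤ} (hu : 0 < h u) (v : ℤ × ℤ) : 0 < h v := by
  obtain ⟨c, hc, h1⟩ := Conn.all v u
  exact lt_of_lt_of_le (by positivity) (h1 h hh.nonneg (fun u => (hh.harm u).le))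

lemma IsH.zero {h : ℤ × ℤ → ℝ} (hh : IsH h) {u : ℤ × ℤ} (hu : h u = 0) (v : ℤ × ℤ) : h v = 0 := by
  by_contra hne
  have := hh.pos (lt_of_le_of_ne (hh.nonneg v) (Ne.symm hne)) u
  linarith

lemma isClosed_H : IsClosed {h : ℤ × ℤ → ℝ | IsH h ∧ h (0, 0) = 1} := by
  have : {h : ℤ × ℤ → ℝ | IsH h ∧ h (0, 0) = 1} =
      ((⋂ u, {h | 0 ≤ h u}) ∩ (⋂ u, {h | PP h u = h u})) ∩ {h | h (0, 0) = 1} := by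
    ext h
    simp only [Set.mem_ofPred_eq, Set.mem_inter_iff, Set.mem_iInter]
    exact ⟨fun a => ⟨⟨a.1.1, a.1.2⟩, a.2⟩, fun a => ⟨⟨a.1.1, a.1.2⟩, a.2⟩⟩
  rw [this]
  refine ((isClosed_iInter fun u => isClosed_le (by fun_prop) (by fun_prop)).inter
    (isClosed_iInter fun u => isClosed_eq ?_ (by fun_prop))).inter
    (isClosed_eq (by fun_prop) (by fun_prop))
  unfold PP
  split_ifs <;> fun_prop

lemma isCompact_H : IsCompact {h : ℤ × ℤ → ℝ | IsH h ∧ h (0, 0) = 1} := by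
  choose c hc hcc using fun u => Conn.all (0, 0) u
  have hK : IsCompact (Set.univ.pi fun u : ℤ × ℤ => Set.Icc (0 : ℝ) (1 / c u)) :=
    isCompact_univ_pi fun u => isCompact_Icc
  refine hK.of_isClosed_subset isClosed_H ?_
  rintro h ⟨hh, h1⟩ u -
  refine ⟨hh.nonneg u, ?_⟩
  rw [le_div_iff₀ (hc u), mul_comm, ← h1]
  exact hcc u h hh.nonneg (fun u => (hh.harm u).le)

lemma axis_mono {h : ℤ × ℤ → ℝ} (hh : IsH h) (k : ℤ) : h (k + 1, 0) ≤ h (k, 0) := by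
  obtain ⟨e, ⟨he, he1⟩, hmax⟩ := isCompact_H.exists_isMaxOn
    ⟨fun _ => 1, ⟨⟨fun _ => zero_le_one, fun u => PP_const 1 u⟩, rfl⟩⟩
    (continuous_apply ((1 : ℤ), (0 : ℤ))).continuousOn
  set M := e (1, 0) with hM
  have hM0 : 0 ≤ M := he.nonneg _
  have key : ∀ h : ℤ × ℤ → ℝ, IsH h → ∀ k : ℤ, h (k + 1, 0) ≤ M * h (k, 0) := by
    intro h hh k
    rcases (hh.nonneg (k, 0)).lt_or_eq with hp | hz
    · have hmem : (fun u => (h (k, 0))⁻¹ * tr k h u + 0 * tr k h u) ∈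
          {h : ℤ × ℤ → ℝ | IsH h ∧ h (0, 0) = 1} := by
        refine ⟨⟨fun u => ?_, fun u => ?_⟩, ?_⟩
        · have := (hh.tr k).nonneg u
          positivity
        · rw [PP_comb, (hh.tr k).harm]
        · simp [tr, hp.ne']
      have := hmax hmem
      simp only [Set.mem_ofPred_eq, tr, zero_mul, add_zero] at this
      rw [inv_mul_le_iff₀ hp, add_comm] at this
      linarith
    · rw [hh.zero hz.symm (k + 1, 0), ← hz]
      simp
  have hg : IsH (fun u => M * e u + (-1) * tr 1 e u) := by
    have harm : ∀ u, PP (fun u => M * e u + (-1) * tr 1 e u) u = M * e u + (-1) * tr 1 e u := by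
      intro u
      rw [PP_comb, he.harm, (he.tr 1).harm]
    refine ⟨max_principle (he.tr 1) harm (fun u => ?_) (fun k => ?_), harm⟩
    · have := mul_nonneg hM0 (he.nonneg u)
      linarith
    · have := key e he k
      simp only [tr]
      linarith
  have hg0 := hg.zero (u := (0, 0)) (by simp [tr, he1, ← hM])
  have hM1 : M ≤ 1 := by
    by_contra! hlt
    obtain ⟨n, hn⟩ := exists_nat_gt (2 / (M - 1))
    rw [div_lt_iff₀ (by linarith)] at hn
    have := tent (fun j => e (0, n + j)) n (M - 1) (by linarith) (fun j => he.nonneg _)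
      (he.pos (u := (0, 0)) (by rw [he1]; exact one_pos) _) ?_
    · linarith
    · intro j hj
      rw [abs_lt] at hj
      have e1 := he.harm (0, n + j)
      rw [PP_pos _ _ _ (by omega)] at e1
      have e2 := hg0 (0, n + j)
      simp only [tr, zero_add] at e1 e2
      rw [← add_assoc, show (n : ℤ) + (j - 1) = n + j - 1 by ring]
      linarith
  refine (key h hh k).trans ?_
  have := mul_le_mul_of_nonneg_right hM1 (hh.nonneg (k, 0))
  linarith

lemma liouville {h : ℤ × ℤ → ℝ} (hh : IsH h) (h1 : h (0, 0) = 1) (u : ℤ × ℤ) : h u = 1 := by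
  have step : ∀ k : ℤ, h (k + 1, 0) = h (k, 0) := by
    intro k
    refine le_antisymm (axis_mono hh k) ?_
    have := axis_mono hh.rf (-(k + 1))
    simpa [rf] using this
  have hax : ∀ k : ℤ, h (k, 0) = 1 := by
    intro k
    induction k using Int.induction_on with
    | zero => exact h1
    | succ k ih => rw [step, ih]
    | pred k ih => rw [← step, sub_add_cancel, ih]
  have hH : IsH (fun u => 1 * h u + 1 * (fun _ => (1 : ℝ)) u) := by
    refine ⟨fun u => ?_, fun u => ?_⟩
    · have := hh.nonneg u
      linarith
    · rw [PP_comb, hh.harm, PP_const]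
  have hc : ∀ a : ℝ, |a| = 1 → 0 ≤ a * h u + (-a) * (fun _ => (1 : ℝ)) u := by
    intro a ha
    have hab := abs_le.1 ha.le
    refine max_principle (g := fun u => a * h u + (-a) * (fun _ => (1 : ℝ)) u) hH
      (fun v => ?_) (fun v => ?_) (fun k => ?_) u
    · rw [PP_comb, hh.harm, PP_const]
    · have := hh.nonneg v
      nlinarith
    · simp [hax]
  have a1 := hc 1 (by simp)
  have a2 := hc (-1) (by simp)
  linarith
/-- Small root of `r ^ 2 + 1 + z * r = 3 * r`. -/
def rr (z : ℂ) : ℂ := ((3 - z) - ((3 - z) ^ 2 - 4) ^ (2⁻¹ : ℂ)) / 2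

lemma rr_eq (z : ℂ) : rr z ^ 2 + 1 + z * rr z = 3 * rr z := by
  have h := Complex.cpow_nat_inv_pow ((3 - z) ^ 2 - 4) (n := 2) (by norm_num)
  simp only [Nat.cast_ofNat] at h
  unfold rr
  linear_combination (1 / 4) * h

lemma rr_facts (z : ℂ) (hz : ‖z‖ = 1) :
    ‖rr z‖ ≤ 1 ∧ 0 ≤ 1 - (rr z).re ∧ ‖1 - z‖ ≤ 10 * (1 - (rr z).re) ^ 2 := by
  have h := rr_eq z
  have hs : 0 ≤ (3 - z - 2 * rr z).re := by
    have : 3 - z - 2 * rr z = ((3 - z) ^ 2 - 4) ^ (2⁻¹ : ℂ) := by unfold rr; ring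
    rw [this, Complex.cpow_inv_two_re]
    exact Real.sqrt_nonneg _
  have hz2 : z.re * z.re + z.im * z.im = 1 := by
    have := Complex.normSq_eq_norm_sq z
    rw [hz, Complex.normSq_apply] at this
    linarith
  generalize rr z = r at *
  have h1 := congrArg Complex.re h
  have h2 := congrArg Complex.im h
  have hN := Complex.normSq_eq_norm_sq r
  rw [Complex.normSq_apply] at hN
  simp [pow_two] at h1 h2 hs
  set a := r.re
  set b := r.im
  set p := z.re
  set q := z.im
  have hp : p ≤ 1 := by nlinarith
  have key : a * (a * a + b * b + 1) = (3 - p) * (a * a + b * b) := by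
    linear_combination a * h1 + b * h2
  have hr0 : r ≠ 0 := by
    rintro rfl
    simp at h
  have hNpos : 0 < a * a + b * b := by
    rw [hN]
    have := norm_pos_iff.2 hr0
    positivity
  have ha : 0 < a := by
    by_contra! hle
    nlinarith
  have hN1 : a * a + b * b ≤ 1 := by
    by_contra! hlt
    nlinarith
  have hn1 : ‖r‖ ≤ 1 := by
    rw [hN] at hN1
    nlinarith [norm_nonneg r]
  have ha1 : 0 ≤ 1 - a := by nlinarith
  refine ⟨hn1, ha1, ?_⟩
  have hb : b * b ≤ (1 - a) ^ 2 := by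
    have e : ((1 - a) ^ 2 - b * b) * a - 2 * (1 - a) * (b * b) = (1 - p) * (a * a + b * b) := by
      linear_combination key
    have : 0 ≤ (1 - p) * (a * a + b * b) := mul_nonneg (by linarith) hNpos.le
    by_contra! hlt
    nlinarith
  have hq : ‖1 - r‖ ^ 2 = ‖1 - z‖ * ‖r‖ := by
    rw [← norm_pow, ← norm_mul]
    congr 1
    linear_combination h
  have hq2 : ‖1 - r‖ ^ 2 = (1 - a) ^ 2 + b * b := by
    rw [← Complex.normSq_eq_norm_sq, Complex.normSq_apply]
    simp
    ring
  have h5 : 1 ≤ ‖r‖ * 5 := by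
    have e : r * (3 - z - r) = 1 := by linear_combination -h
    have : ‖r‖ * ‖3 - z - r‖ = 1 := by rw [← norm_mul, e, norm_one]
    rw [← this]
    apply mul_le_mul_of_nonneg_left _ (norm_nonneg r)
    have n1 := norm_sub_le (3 - z) r
    have n2 := norm_sub_le 3 z
    have n3 : ‖(3 : ℂ)‖ = 3 := by simp
    linarith
  have := mul_le_mul_of_nonneg_left h5 (norm_nonneg (1 - z))
  nlinarith

/-- The point `exp (i θ)`. -/
def zz (θ : ℝ) : ℂ := Complex.exp (θ * Complex.I)

lemma zz_norm (θ : ℝ) : ‖zz θ‖ = 1 := Complex.norm_exp_ofReal_mul_I θ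

/-- `1 - Re r`. -/
def dd (θ : ℝ) : ℝ := 1 - (rr (zz θ)).re

lemma dd_bound (θ : ℝ) (h0 : 0 < θ) (h1 : θ ≤ Real.pi) :
    0 < dd θ ∧ (dd θ)⁻¹ ≤ 5 * θ ^ (-(1 / 2) : ℝ) := by
  obtain ⟨-, h2, h3⟩ := rr_facts (zz θ) (zz_norm θ)
  change 0 ≤ dd θ at h2
  change _ ≤ 10 * dd θ ^ 2 at h3
  have hD : θ / 2 ≤ ‖1 - zz θ‖ := by
    have e : ‖1 - zz θ‖ ^ 2 = 4 * Real.sin (θ / 2) ^ 2 := by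
      rw [← Complex.normSq_eq_norm_sq, Complex.normSq_apply]
      simp [zz, Complex.exp_ofReal_mul_I_re, Complex.exp_ofReal_mul_I_im]
      have := Real.cos_sq_add_sin_sq θ
      have := Real.sin_sq_eq_half_sub (θ / 2)
      rw [show 2 * (θ / 2) = θ by ring] at this
      nlinarith
    have hs := Real.mul_le_sin (x := θ / 2) (by linarith) (by linarith)
    have : θ / 4 ≤ 2 / Real.pi * (θ / 2) := by
      rw [div_mul_eq_mul_div, div_le_div_iff₀ (by norm_num) Real.pi_pos]
      nlinarith [Real.pi_lt_four]
    have h6 : θ / 4 ≤ Real.sin (θ / 2) := this.trans hs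
    have h7 : (θ / 2) ^ 2 ≤ ‖1 - zz θ‖ ^ 2 := by
      rw [e]; nlinarith
    exact le_of_sq_le_sq h7 (norm_nonneg _)
  have hd : 0 < dd θ := by
    rcases h2.lt_or_eq with h | h
    · exact h
    · rw [← h] at h3
      linarith
  refine ⟨hd, ?_⟩
  rw [Real.rpow_neg h0.le, ← Real.sqrt_eq_rpow, ← div_eq_mul_inv, le_div_iff₀ (by positivity),
    inv_mul_le_iff₀ hd, mul_comm]
  apply Real.sqrt_le_iff.2
  constructor
  · positivity
  · nlinarith

/-- Elementary eigenfunctions. -/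
def EE (u : ℤ × ℤ) (θ : ℝ) : ℂ :=
  zz θ ^ u.1 * (if 0 ≤ u.2 then rr (zz θ) ^ u.2.toNat
    else (starRingEnd ℂ (rr (zz θ))) ^ (-u.2).toNat)

lemma zz_ne (θ : ℝ) : zz θ ≠ 0 := Complex.exp_ne_zero _

lemma zz_inv (θ : ℝ) : (zz θ)⁻¹ = starRingEnd ℂ (zz θ) := by
  rw [Complex.inv_def, Complex.normSq_eq_norm_sq, zz_norm]
  simp

lemma EE_norm (u : ℤ × ℤ) (θ : ℝ) : ‖EE u θ‖ ≤ 1 := by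
  have h := (rr_facts (zz θ) (zz_norm θ)).1
  unfold EE
  rw [norm_mul, norm_zpow, zz_norm, one_zpow, one_mul]
  split_ifs
  · rw [norm_pow]
    exact pow_le_one₀ (norm_nonneg _) h
  · rw [norm_pow, Complex.norm_conj]
    exact pow_le_one₀ (norm_nonneg _) h

lemma EE_pos (x : ℤ) (n : ℕ) (θ : ℝ) : EE (x, n) θ = zz θ ^ x * rr (zz θ) ^ n := by
  simp [EE]

lemma EE_neg (x : ℤ) (n : ℕ) (θ : ℝ) :
    EE (x, -n) θ = zz θ ^ x * (starRingEnd ℂ (rr (zz θ))) ^ n := by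
  rcases n with _ | n
  · simp [EE]
  · unfold EE
    simp only
    rw [if_neg (by push_cast; omega)]
    simp

lemma EE_zero (x : ℤ) (θ : ℝ) : (EE (x, 0) θ).re = Real.cos (x * θ) := by
  have := EE_pos x 0 θ
  simp only [Nat.cast_zero, pow_zero, mul_one] at this
  rw [this, zz, ← Complex.exp_int_mul, ← Complex.exp_ofReal_mul_I_re]
  congr 2
  push_cast
  ring

/-- Real integrand. -/
def II (θ : ℝ) (u : ℤ × ℤ) : ℝ := (EE u θ).re / dd θ

lemma PP_II (θ : ℝ) (hd : dd θ ≠ 0) (u : ℤ × ℤ) :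
    PP (II θ) u = II θ u - if u.2 = 0 then Real.cos (u.1 * θ) else 0 := by
  obtain ⟨x, y⟩ := u
  have hr := rr_eq (zz θ)
  have hc := congrArg (starRingEnd ℂ) hr
  simp only [map_add, map_mul, map_pow, map_one, map_ofNat, ← zz_inv] at hc
  rcases lt_trichotomy y 0 with h | h | h
  · rw [PP_neg _ _ _ h, if_neg (by simp only; omega)]
    obtain ⟨n, rfl⟩ : ∃ n : ℕ, y = -((n + 1 : ℕ) : ℤ) := ⟨(-y - 1).toNat, by push_cast; omega⟩
    have e1 : -((n + 1 : ℕ) : ℤ) + 1 = -(n : ℤ) := by push_cast; ring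
    have e2 : -((n + 1 : ℕ) : ℤ) - 1 = -((n + 2 : ℕ) : ℤ) := by push_cast; ring
    have key : EE (x, -(n : ℤ)) θ + EE (x, -((n + 2 : ℕ) : ℤ)) θ +
        EE (x - 1, -((n + 1 : ℕ) : ℤ)) θ = 3 * EE (x, -((n + 1 : ℕ) : ℤ)) θ := by
      rw [EE_neg, EE_neg, EE_neg, EE_neg, zpow_sub_one₀ (zz_ne θ)]
      linear_combination zz θ ^ x * (starRingEnd ℂ (rr (zz θ))) ^ n * hc
    have := congrArg Complex.re key
    simp at this
    rw [e1, e2]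
    simp only [II]
    push_cast
    rw [← add_div, ← add_div, sub_zero, div_right_comm]
    congr 1
    simp only [neg_add_rev] at this ⊢
    linarith
  · subst h
    rw [PP_zero, if_pos rfl, ← EE_zero]
    have a1 := EE_pos x 1 θ
    have a2 := EE_neg x 1 θ
    have a0 := EE_pos x 0 θ
    simp only [Nat.cast_one, Nat.cast_zero, pow_one, pow_zero, mul_one] at a0 a1 a2
    have hsum : rr (zz θ) + starRingEnd ℂ (rr (zz θ)) = ((2 * (1 - dd θ) : ℝ) : ℂ) := by
      rw [Complex.add_conj]
      simp [dd]
    have key : EE (x, 1) θ + EE (x, -1) θ = ((2 * (1 - dd θ) : ℝ) : ℂ) * EE (x, 0) θ := by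
      rw [a0, a1, a2, ← hsum]
      ring
    have := congrArg Complex.re key
    rw [Complex.re_ofReal_mul, Complex.add_re] at this
    simp only [II]
    rw [← add_div, this]
    field_simp
  · rw [PP_pos _ _ _ h, if_neg (by simp only; omega)]
    obtain ⟨n, rfl⟩ : ∃ n : ℕ, y = ((n + 1 : ℕ) : ℤ) := ⟨(y - 1).toNat, by push_cast; omega⟩
    have e1 : ((n + 1 : ℕ) : ℤ) + 1 = ((n + 2 : ℕ) : ℤ) := by push_cast; ring
    have e2 : ((n + 1 : ℕ) : ℤ) - 1 = (n : ℤ) := by push_cast; ring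
    have key : EE (x, ((n + 2 : ℕ) : ℤ)) θ + EE (x, (n : ℤ)) θ +
        EE (x + 1, ((n + 1 : ℕ) : ℤ)) θ = 3 * EE (x, ((n + 1 : ℕ) : ℤ)) θ := by
      rw [EE_pos, EE_pos, EE_pos, EE_pos, zpow_add_one₀ (zz_ne θ)]
      linear_combination zz θ ^ x * rr (zz θ) ^ n * hr
    have := congrArg Complex.re key
    simp at this
    rw [e1, e2]
    simp only [II]
    push_cast
    rw [← add_div, ← add_div, sub_zero, div_right_comm]
    congr 1
    linarith

lemma II_meas (u : ℤ × ℤ) : Measurable (fun θ => II θ u) := by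
  have hz : Measurable zz := by unfold zz; fun_prop
  have hr : Measurable (fun θ => rr (zz θ)) := by
    unfold rr
    fun_prop
  have hd : Measurable dd := by
    unfold dd
    fun_prop
  unfold II
  refine Measurable.div ?_ hd
  refine Complex.measurable_re.comp ?_
  unfold EE
  refine Measurable.mul ?_ ?_
  · exact hz.pow_const _
  · split_ifs
    · fun_prop
    · exact ((Complex.continuous_conj.measurable.comp hr).pow_const _)

lemma II_bound (u : ℤ × ℤ) (θ : ℝ) (h : θ ∈ Set.Ioc 0 Real.pi) :
    ‖II θ u‖ ≤ 5 * θ ^ (-(1 / 2) : ℝ) := by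
  obtain ⟨h1, h2⟩ := dd_bound θ h.1 h.2
  refine le_trans ?_ h2
  unfold II
  rw [norm_div, Real.norm_of_nonneg h1.le, div_eq_mul_inv]
  have : ‖(EE u θ).re‖ ≤ 1 := (Complex.abs_re_le_norm _).trans (EE_norm u θ)
  have h3 := inv_pos.2 h1
  nlinarith

lemma bound_int : IntervalIntegrable (fun θ : ℝ => 5 * θ ^ (-(1 / 2) : ℝ))
    MeasureTheory.volume 0 Real.pi :=
  (intervalIntegral.intervalIntegrable_rpow' (by norm_num)).const_mul 5

lemma II_int (u : ℤ × ℤ) :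
    IntervalIntegrable (fun θ => II θ u) MeasureTheory.volume 0 Real.pi := by
  refine bound_int.mono_fun' (II_meas u).aestronglyMeasurable ?_
  rw [Set.uIoc_of_le Real.pi_pos.le]
  filter_upwards [MeasureTheory.ae_restrict_mem measurableSet_Ioc] with θ hθ
  exact II_bound u θ hθ

/-- A bounded function, harmonic off the origin and strictly superharmonic there. -/
def ss (u : ℤ × ℤ) : ℝ := ∫ θ in (0 : ℝ)..Real.pi, II θ u

lemma ss_bound (u : ℤ × ℤ) : |ss u| ≤ ∫ θ in (0 : ℝ)..Real.pi, 5 * θ ^ (-(1 / 2) : ℝ) := by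
  have := intervalIntegral.norm_integral_le_of_norm_le (f := fun θ => II θ u) Real.pi_pos.le
    (Filter.Eventually.of_forall fun θ hθ => II_bound u θ hθ) bound_int
  exact this

lemma PP_ss (u : ℤ × ℤ) : PP ss u + (if u = (0, 0) then Real.pi else 0) = ss u := by
  have e1 : PP ss u = ∫ θ in (0 : ℝ)..Real.pi, PP (II θ) u := by
    unfold PP ss
    split_ifs
    · rw [intervalIntegral.integral_div, intervalIntegral.integral_add
        ((II_int _).add (II_int _)) (II_int _), intervalIntegral.integral_add (II_int _) (II_int _)]
    · rw [intervalIntegral.integral_div, intervalIntegral.integral_add (II_int _) (II_int _)]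
  have hcos : IntervalIntegrable (fun θ : ℝ => if u.2 = 0 then Real.cos (u.1 * θ) else 0)
      MeasureTheory.volume 0 Real.pi := by
    apply Continuous.intervalIntegrable
    split_ifs <;> fun_prop
  have e2 : (∫ θ in (0 : ℝ)..Real.pi, PP (II θ) u) =
      ∫ θ in (0 : ℝ)..Real.pi, (II θ u - if u.2 = 0 then Real.cos (u.1 * θ) else 0) := by
    refine intervalIntegral.integral_congr_ae (Filter.Eventually.of_forall fun θ hθ => ?_)
    rw [Set.uIoc_of_le Real.pi_pos.le] at hθ
    exact PP_II θ (dd_bound θ hθ.1 hθ.2).1.ne' u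
  rw [e1, e2, intervalIntegral.integral_sub (II_int u) hcos]
  have e3 : (∫ θ in (0 : ℝ)..Real.pi, if u.2 = 0 then Real.cos (u.1 * θ) else 0) =
      if u = (0, 0) then Real.pi else 0 := by
    obtain ⟨x, y⟩ := u
    by_cases hy : y = 0
    · subst hy
      by_cases hx : x = 0
      · subst hx
        simp
      · have hx' : (x : ℝ) ≠ 0 := by exact_mod_cast hx
        simp only [if_true, Prod.mk.injEq, hx, and_true, if_false]
        rw [intervalIntegral.integral_comp_mul_left (fun t => Real.cos t) hx', integral_cos]
        simp [Real.sin_int_mul_pi]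
    · simp [hy]
  rw [e3]
  unfold ss
  ring
lemma kernel_support (v w : ℤ × ℤ)
    (hw : w ∉ ({(v.1, v.2 + 1), (v.1, v.2 - 1), (v.1 - Int.sign v.2, v.2)} : Finset (ℤ × ℤ))) :
    halfPlaneKernel w v = 0 := by
  obtain ⟨a, b⟩ := v
  obtain ⟨x, y⟩ := w
  simp only [Finset.mem_insert, Finset.mem_singleton, Prod.mk.injEq, not_or, not_and] at hw
  obtain ⟨h1, h2, h3⟩ := hw
  unfold halfPlaneKernel
  simp only [Prod.mk.injEq]
  have h4 : ¬ (a = x + y.sign ∧ b = y) := by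
    rintro ⟨q1, q2⟩
    subst q2
    exact h3 (by omega) rfl
  rw [if_neg h4]
  split_ifs <;> first | (norm_num; done) | (exfalso; omega)

lemma kernel_summable (f : ℤ × ℤ → ℝ) (v : ℤ × ℤ) :
    Summable (fun w => f w * halfPlaneKernel w v) := by
  apply summable_of_ne_finset_zero
    (s := ({(v.1, v.2 + 1), (v.1, v.2 - 1), (v.1 - Int.sign v.2, v.2)} : Finset (ℤ × ℤ)))
  intro w hw
  rw [kernel_support v w hw, mul_zero]

lemma kernel_eq_PP (u v : ℤ × ℤ) :
    halfPlaneKernel u v = PP (fun w => if w = v then 1 else 0) u := by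
  unfold halfPlaneKernel PP
  simp only [eq_comm (a := v)]
  split_ifs <;> norm_num

lemma kernelPow_left (n : ℕ) : ∀ u v, kernelPow (n + 1) u v = PP (fun w => kernelPow n w v) u := by
  induction n with
  | zero =>
    intro u v
    rw [kernelPow, tsum_eq_single u]
    · simp only [kernelPow, if_true, one_mul]
      exact kernel_eq_PP u v
    · intro w hw
      simp [kernelPow, hw.symm]
  | succ n ih =>
    intro u v
    rw [kernelPow]
    simp only [ih u]
    have e : (fun w => kernelPow (n + 1) w v) =
        fun u => ∑' w : ℤ × ℤ, kernelPow n u w * halfPlaneKernel w v := by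
      funext u
      rw [kernelPow]
    rw [e]
    unfold PP
    have hs := fun u => kernel_summable (kernelPow n u) v
    split_ifs
    · rw [← (hs _).tsum_add (hs _), ← ((hs _).add (hs _)).tsum_add (hs _), ← tsum_div_const]
      congr 1
      funext w
      ring
    · rw [← (hs _).tsum_add (hs _), ← tsum_div_const]
      congr 1
      funext w
      ring

lemma kernelPow_nonneg (n : ℕ) : ∀ u v, 0 ≤ kernelPow n u v := by
  induction n with
  | zero => intro u v; simp only [kernelPow]; split_ifs <;> norm_num
  | succ n ih => intro u v; rw [kernelPow_left]; exact PP_nonneg (fun w => ih w v) u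

lemma kernel_nonneg (u v : ℤ × ℤ) : 0 ≤ halfPlaneKernel u v := by
  rw [kernel_eq_PP]
  exact PP_nonneg (fun w => by split_ifs <;> norm_num) u

lemma kernelPow_right (n : ℕ) (u v w : ℤ × ℤ) :
    kernelPow n u w * halfPlaneKernel w v ≤ kernelPow (n + 1) u v := by
  rw [kernelPow]
  exact (kernel_summable (kernelPow n u) v).le_tsum w
    (fun j _ => mul_nonneg (kernelPow_nonneg n u j) (kernel_nonneg j v))

lemma summable_axis (u : ℤ × ℤ) (c : ℤ) : Summable (fun n => kernelPow n u (c, 0)) := by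
  set B := ∫ θ in (0 : ℝ)..Real.pi, 5 * θ ^ (-(1 / 2) : ℝ)
  have key : ∀ n, ∀ u : ℤ × ℤ,
      ∑ i ∈ Finset.range n, kernelPow i u (c, 0) ≤ Real.pi⁻¹ * (tr (-c) ss u + B) := by
    intro n
    induction n with
    | zero =>
      intro u
      have := abs_le.1 (ss_bound (u.1 + -c, u.2))
      have h2 : 0 ≤ tr (-c) ss u + B := by simp only [tr]; linarith
      simp only [Finset.range_zero, Finset.sum_empty]
      have := Real.pi_pos
      positivity
    | succ n ih =>
      intro u
      have h1 : ∑ i ∈ Finset.range (n + 1), kernelPow i u (c, 0) =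
          PP (fun w => ∑ i ∈ Finset.range n, kernelPow i w (c, 0)) u +
            if u = (c, 0) then 1 else 0 := by
        rw [Finset.sum_range_succ']
        congr 1
        simp only [kernelPow_left]
        unfold PP
        split_ifs
        · rw [← Finset.sum_div, Finset.sum_add_distrib, Finset.sum_add_distrib]
        · rw [← Finset.sum_div, Finset.sum_add_distrib]
      rw [h1]
      have h2 := PP_mono ih u
      have h3 : PP (fun u => Real.pi⁻¹ * (tr (-c) ss u + B)) u =
          Real.pi⁻¹ * PP (tr (-c) ss) u + Real.pi⁻¹ * B := by
        have := PP_comb Real.pi⁻¹ Real.pi⁻¹ (tr (-c) ss) (fun _ => B) u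
        rw [PP_const] at this
        rw [← this]
        congr 1
        funext w
        ring
      rw [h3, PP_tr] at h2
      have h4 := PP_ss (u.1 + -c, u.2)
      have h5 : (if u = (c, 0) then (1 : ℝ) else 0) =
          Real.pi⁻¹ * (if ((u.1 + -c, u.2) : ℤ × ℤ) = (0, 0) then Real.pi else 0) := by
        have : (((u.1 + -c, u.2) : ℤ × ℤ) = (0, 0)) ↔ u = (c, 0) := by
          obtain ⟨x, y⟩ := u
          simp only [Prod.mk.injEq]
          omega
        simp only [this]
        split_ifs
        · field_simp
        · simp
      rw [h5]
      simp only [tr]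
      rw [← h4]
      linarith
  exact summable_of_sum_range_le (fun n => kernelPow_nonneg n u _) (fun n => key n u)

lemma summable_step (u v w : ℤ × ℤ) (hk : 1 / 3 ≤ halfPlaneKernel w v)
    (h : Summable (fun n => kernelPow n u v)) : Summable (fun n => kernelPow n u w) := by
  have h1 : Summable (fun n => 3 * kernelPow (n + 1) u v) :=
    ((summable_nat_add_iff 1).2 h).mul_left 3
  refine Summable.of_nonneg_of_le (fun n => kernelPow_nonneg n u w) (fun n => ?_) h1
  have := kernelPow_right n u v w
  have := kernelPow_nonneg n u w
  nlinarith

lemma summable_all (u v : ℤ × ℤ) : Summable (fun n => kernelPow n u v) := by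
  obtain ⟨c, d⟩ := v
  induction d using Int.induction_on with
  | zero => exact summable_axis u c
  | succ k ih =>
    refine summable_step u _ _ ?_ ih
    unfold halfPlaneKernel
    simp only
    rw [if_pos (by omega)]
    have h1 : ¬ ((k : ℤ) = k + 1 + 1) := by omega
    simp [h1]
  | pred k ih =>
    refine summable_step u _ _ ?_ ih
    unfold halfPlaneKernel
    simp only
    rw [if_pos (by omega)]
    have h1 : ¬ (-(k : ℤ) = -k - 1 - 1) := by omega
    simp [h1]
    split_ifs <;> norm_num

lemma green_nonneg (u v : ℤ × ℤ) : 0 ≤ greenFn u v := tsum_nonneg (fun n => kernelPow_nonneg n u v)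

lemma green_eq (u v : ℤ × ℤ) :
    greenFn u v = (if u = v then 1 else 0) + PP (fun w => greenFn w v) u := by
  have hs := fun u => summable_all u v
  unfold greenFn
  rw [(hs u).tsum_eq_zero_add]
  congr 1
  simp only [kernelPow_left]
  unfold PP
  split_ifs
  · rw [tsum_div_const, ((hs _).add (hs _)).tsum_add (hs _), (hs _).tsum_add (hs _)]
  · rw [tsum_div_const, (hs _).tsum_add (hs _)]

lemma green_super (u v : ℤ × ℤ) : PP (fun w => greenFn w v) u ≤ greenFn u v := by
  rw [green_eq u v]
  split_ifs <;> linarith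

lemma green_pos (u v : ℤ × ℤ) : 0 < greenFn u v := by
  obtain ⟨c, hc, h⟩ := Conn.all u v
  have h1 := h (fun w => greenFn w v) (fun w => green_nonneg w v) (fun w => green_super w v)
  have h2 : 1 ≤ greenFn v v := by
    rw [green_eq, if_pos rfl]
    linarith [PP_nonneg (fun w => green_nonneg w v) v]
  nlinarith

/-- The Martin kernel `K(x,y) = G(x,y)/G((0,0),y)` of the simple random walk on the
half-plane one-way lattice tends to `1` as `|y₁| + |y₂| → ∞`: the Martin boundary is
trivial. -/
theorem martin_boundary_trivial (x : ℤ × ℤ) :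
    Tendsto (fun y : ℤ × ℤ => greenFn x y / greenFn (0, 0) y)
      (Filter.comap (fun y : ℤ × ℤ => |y.1| + |y.2|) Filter.atTop) (nhds 1) := by
  rw [tendsto_iff_ultrafilter]
  intro U hU
  choose c hc hcc using fun u => Conn.all (0, 0) u
  have hK : IsCompact (Set.univ.pi fun u : ℤ × ℤ => Set.Icc (0 : ℝ) (1 / c u)) :=
    isCompact_univ_pi fun u => isCompact_Icc
  let F : ℤ × ℤ → (ℤ × ℤ → ℝ) := fun y u => greenFn u y / greenFn (0, 0) y
  have hF : ∀ y, F y ∈ Set.univ.pi fun u : ℤ × ℤ => Set.Icc (0 : ℝ) (1 / c u) := by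
    intro y u _
    refine ⟨div_nonneg (green_nonneg _ _) (green_nonneg _ _), ?_⟩
    simp only [F]
    rw [div_le_div_iff₀ (green_pos _ _) (hc u), one_mul, mul_comm]
    exact hcc u (fun w => greenFn w y) (fun w => green_nonneg w y) (fun w => green_super w y)
  obtain ⟨h, -, hlim⟩ := isCompact_iff_ultrafilter_le_nhds.1 hK (U.map F) (by
    rw [le_principal_iff]
    exact Filter.mem_map.2 (Filter.univ_mem' hF))
  have hlim' : Tendsto F U (nhds h) := hlim
  rw [tendsto_pi_nhds] at hlim'
  have hH : IsH h := by
    refine ⟨fun u => ge_of_tendsto' (hlim' u) (fun y => (hF y u trivial).1), fun u => ?_⟩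
    refine tendsto_nhds_unique (PP_tendsto hlim' u) ((hlim' u).congr' ?_)
    have hne : ∀ᶠ y in Filter.comap (fun y : ℤ × ℤ => |y.1| + |y.2|) Filter.atTop, u ≠ y := by
      have : ∀ᶠ t : ℤ in atTop, |u.1| + |u.2| < t := eventually_gt_atTop _
      filter_upwards [preimage_mem_comap this] with y hy hyu
      subst hyu
      exact lt_irrefl (|u.1| + |u.2|) hy
    filter_upwards [hU hne] with y hy
    have h1 := green_eq u y
    rw [if_neg hy, zero_add] at h1
    have h2 := PP_comb (greenFn (0, 0) y)⁻¹ 0 (fun w => greenFn w y) (fun _ => 0) u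
    simp only [zero_mul, add_zero] at h2
    rw [← h1] at h2
    simp only [F, div_eq_inv_mul]
    exact h2.symm
  have h1 : h (0, 0) = 1 := by
    refine tendsto_nhds_unique (hlim' (0, 0)) ?_
    have : (fun y => F y (0, 0)) = fun _ => 1 := by
      funext y
      exact div_self (green_pos _ _).ne'
    rw [this]
    exact tendsto_const_nhds
  have := hlim' x
  rw [liouville hH h1 x] at this
  exact this
end
end

section
/- For every x ∈ ℤ, the ratio γ(y−x)/γ(y) tends to 1 as |y| → ∞ along y ∈ ℤ. (This is the Martin kernel K₀(x,y) = G₀(x,y)/G₀(0,y) of the Markov chain induced on the horizontal axis by the simple random walk on ℍ at its successive return times to the axis; hence the Martin boundary of the induced chain is trivial.) -/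
open Filter Real Complex

noncomputable section

/-- `w(t) = 3 - 2 exp(it)`. -/
def wFn (t : ℝ) : ℂ := 3 - 2 * Complex.exp (Complex.I * t)

/-- `φ(t) = Re(w(t)² - w(t)·√(w(t)²-1))`, the characteristic function of the horizontal
displacement between successive visits to the horizontal axis of the simple random walk
on the half-plane one-way lattice ℍ (principal branch of the complex square root). -/
def phiFn (t : ℝ) : ℝ := (wFn t ^ 2 - wFn t * (wFn t ^ 2 - 1) ^ ((1 : ℂ) / 2)).re

/-- `γ(x) = ∫₀^π cos(xt)/(1 - φ(t)) dt`, the Green function of the induced chain on the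
horizontal axis. -/
def gammaFn (x : ℝ) : ℝ := ∫ t in (0 : ℝ)..Real.pi, Real.cos (x * t) / (1 - phiFn t)


def scR (t : ℝ) : ℝ := (dslope Complex.sin 0 (t : ℂ)).re

lemma scR_mul (t : ℝ) : t * scR t = Real.sin t := by
  have h := sub_smul_dslope Complex.sin 0 (t : ℂ)
  have h2 := congrArg Complex.re h
  rw [← Complex.sin_ofReal_re t]
  simpa [scR] using h2

lemma scR_zero : scR 0 = 1 := by simp [scR]

lemma scR_contDiff : ContDiff ℝ 1 scR := by
  have h : Differentiable ℂ (dslope Complex.sin 0) := by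
    rw [← differentiableOn_univ]
    exact (Complex.differentiableOn_dslope (by simp)).2 Complex.differentiable_sin.differentiableOn
  have h2 : ContDiff ℝ 1 (dslope Complex.sin 0) := (h.contDiff (n := 1)).restrict_scalars ℝ
  exact Complex.reCLM.contDiff.comp (h2.comp Complex.ofRealCLM.contDiff)

lemma scR_pos {t : ℝ} (h0 : 0 ≤ t) (h1 : t < Real.pi) : 0 < scR t := by
  rcases h0.eq_or_lt with rfl | h
  · rw [scR_zero]; norm_num
  · have := Real.sin_pos_of_pos_of_lt_pi h h1
    rw [← scR_mul] at this
    exact pos_of_mul_pos_right this h0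

def eF (t : ℝ) : ℂ := Complex.exp (Complex.I * (t - Real.pi) / 4)
def qF (t : ℝ) : ℂ := Complex.exp (Complex.log (2 - Complex.exp (Complex.I * t)) / 2)

lemma expI_re (t : ℝ) : (Complex.exp (Complex.I * t)).re = Real.cos t := by
  rw [mul_comm, Complex.exp_ofReal_mul_I_re]

lemma two_sub_re (t : ℝ) : 0 < (2 - Complex.exp (Complex.I * t)).re := by
  rw [Complex.sub_re, expI_re]
  have := Real.cos_le_one t
  simp; linarith

lemma eF_contDiff : ContDiff ℝ 1 eF := by
  have h : ContDiff ℝ 1 (fun t : ℝ => (t : ℂ)) := Complex.ofRealCLM.contDiff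
  have : ContDiff ℝ 1 (fun t : ℝ => Complex.I * ((t : ℂ) - Real.pi) / 4) := by fun_prop
  exact this.cexp

lemma wFn_contDiff : ContDiff ℝ 1 wFn := by
  have h : ContDiff ℝ 1 (fun t : ℝ => (t : ℂ)) := Complex.ofRealCLM.contDiff
  have : ContDiff ℝ 1 (fun t : ℝ => Complex.I * (t : ℂ)) := by fun_prop
  exact contDiff_const.sub (contDiff_const.mul this.cexp)

lemma qF_contDiff : ContDiff ℝ 1 qF := by
  have h : ContDiff ℝ 1 (fun t : ℝ => (t : ℂ)) := Complex.ofRealCLM.contDiff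
  have h1 : ContDiff ℝ 1 (fun t : ℝ => Complex.I * (t : ℂ)) := by fun_prop
  have h2 : ContDiff ℝ 1 (fun t : ℝ => 2 - Complex.exp (Complex.I * (t : ℂ))) :=
    contDiff_const.sub h1.cexp
  have h3 : ContDiff ℝ 1 (fun t : ℝ => Complex.log (2 - Complex.exp (Complex.I * (t : ℂ)))) := by
    rw [contDiff_iff_contDiffAt]
    intro t
    have := (Complex.contDiffAt_log (n := 1) (Or.inl (two_sub_re t))).restrict_scalars ℝ
    exact this.comp t h2.contDiffAt
  exact (h3.div_const 2).cexp

lemma qF_sq (t : ℝ) : qF t ^ 2 = 2 - Complex.exp (Complex.I * t) := by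
  have h0 : (2 - Complex.exp (Complex.I * t)) ≠ 0 := by
    intro h; have := two_sub_re t; rw [h] at this; simp at this
  rw [qF, ← Complex.exp_nat_mul]
  rw [show ((2:ℕ):ℂ) * (Complex.log (2 - Complex.exp (Complex.I * t)) / 2) =
    Complex.log (2 - Complex.exp (Complex.I * t)) by push_cast; ring, Complex.exp_log h0]

lemma qF_re (t : ℝ) : 0 < (qF t).re := by
  rw [qF, Complex.exp_re]
  have h : |(2 - Complex.exp (Complex.I * t)).arg| < Real.pi / 2 :=
    Complex.abs_arg_lt_pi_div_two_iff.2 (Or.inl (two_sub_re t))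
  rw [abs_lt] at h
  apply mul_pos (Real.exp_pos _)
  have h3 : (Complex.log (2 - Complex.exp (Complex.I * t)) / 2).im = (2 - Complex.exp (Complex.I * t)).arg / 2 := by
    rw [← Complex.log_im]; simp
  rw [h3]
  apply Real.cos_pos_of_mem_Ioo
  constructor <;> linarith [Real.pi_pos]

lemma eF_sq (t : ℝ) : 2 * (Real.sin (t / 2) : ℂ) * eF t ^ 2 = 1 - Complex.exp (Complex.I * t) := by
  have h1 : eF t ^ 2 = Complex.exp (Complex.I * t / 2) * (-Complex.I) := by
    rw [eF, ← Complex.exp_nat_mul,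
      show ((2:ℕ):ℂ) * (Complex.I * (t - Real.pi) / 4) = Complex.I * t / 2 + (-(Real.pi / 2 * Complex.I)) by
        push_cast; ring, Complex.exp_add, Complex.exp_neg, Complex.exp_pi_div_two_mul_I, Complex.inv_I]
  rw [h1, Complex.ofReal_sin, Complex.sin]
  push_cast
  have e1 : Complex.exp (Complex.I * t) = Complex.exp (Complex.I * t / 2) ^ 2 := by
    rw [← Complex.exp_nat_mul]; congr 1; push_cast; ring
  have e2 : Complex.exp ((t:ℂ) / 2 * Complex.I) = Complex.exp (Complex.I * t / 2) := by
    congr 1; ring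
  have e3 : Complex.exp (-((t:ℂ) / 2) * Complex.I) * Complex.exp (Complex.I * t / 2) = 1 := by
    rw [← Complex.exp_add]; simp; ring_nf; simp
  rw [e1, e2]
  linear_combination (norm := (ring_nf; simp; try ring)) e3

lemma eF_re {t : ℝ} (h0 : 0 ≤ t) (h1 : t ≤ Real.pi) : 0 < (eF t).re := by
  have : eF t = Complex.exp (((t - Real.pi) / 4 : ℝ) * Complex.I) := by
    rw [eF]; congr 1; push_cast; ring
  rw [this, Complex.exp_ofReal_mul_I_re]
  apply Real.cos_pos_of_mem_Ioo
  constructor <;> linarith [Real.pi_pos]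

/-- key algebraic facts -/
lemma key_alg (p q : ℂ) (hp : 0 < p.re) (hq : 0 < q.re) (hp2 : 0 ≤ (p ^ 2).re) (hq2 : 0 < (q ^ 2).re)
    (h : q ^ 2 - p ^ 2 = 1) :
    0 < (2 * p * q).re ∧ 0 < (2 * p * q * (p - q) ^ 2).re := by
  obtain ⟨a, b⟩ := p
  obtain ⟨c, d⟩ := q
  simp only [pow_two, Complex.mul_re, Complex.sub_re, Complex.sub_im, Complex.mul_im] at *
  have hb : |b| ≤ a := abs_le_of_sq_le_sq (by nlinarith) hp.le
  have hd : |d| < c := abs_lt_of_sq_lt_sq (by nlinarith) hq.le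
  have hbd : |b * d| < a * c := by
    rw [abs_mul]
    exact mul_lt_mul_of_nonneg_of_pos' hb hd (abs_nonneg _) hp
  rw [abs_lt] at hbd
  have h1 : (c * c - d * d) - (a * a - b * b) = 1 := by simpa using congrArg Complex.re h
  have h2 : (c * d + d * c) - (a * b + b * a) = 0 := by simpa using congrArg Complex.im h
  constructor
  · simp; nlinarith
  · set p : ℂ := ⟨a, b⟩
    set q : ℂ := ⟨c, d⟩
    have h3 : (p - q) ^ 2 * (p + q) ^ 2 = 1 := by
      have : (p - q) * (p + q) = -1 := by linear_combination -h
      rw [← mul_pow, this]; norm_num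
    have h4 : (p + q) * (starRingEnd ℂ) (p + q) = (Complex.normSq (p + q) : ℂ) := Complex.mul_conj _
    have h5 : 2 * p * q * (p - q) ^ 2 * ((Complex.normSq (p + q) ^ 2 : ℝ) : ℂ) =
        2 * p * q * (starRingEnd ℂ) (p + q) ^ 2 := by
      push_cast
      rw [← h4]
      linear_combination (2 * p * q * (starRingEnd ℂ) (p + q) ^ 2) * h3
    have h6 := congrArg Complex.re h5
    rw [Complex.re_mul_ofReal] at h6
    have h7 : (2 * p * q * (starRingEnd ℂ) (p + q) ^ 2).re =
        2 * ((a ^ 2 + b ^ 2) + (c ^ 2 + d ^ 2)) * (a * c + b * d) +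
          4 * ((a ^ 2 + b ^ 2) * (c ^ 2 + d ^ 2)) := by
      simp [p, q, pow_two]; ring
    have h8 : 0 < (2 * p * q * (starRingEnd ℂ) (p + q) ^ 2).re := by
      rw [h7]
      have : 0 < a * c + b * d := by linarith
      positivity
    rw [← h6] at h8
    have := pos_of_mul_pos_left h8 (by positivity)
    simpa only [pow_two, Complex.mul_re, Complex.sub_re, Complex.sub_im, Complex.mul_im] using this

lemma phi_eq {t : ℝ} (h0 : 0 < t) (h1 : t ≤ Real.pi) :
    1 - phiFn t = √(2 * Real.sin (t / 2)) *
      ((2 * eF t * qF t * wFn t).re - √(2 * Real.sin (t / 2)) * ((2 * eF t * qF t) ^ 2).re) ∧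
    0 < 1 - phiFn t := by
  have hs : 0 < Real.sin (t / 2) := Real.sin_pos_of_pos_of_lt_pi (by linarith) (by linarith)
  set r : ℝ := √(2 * Real.sin (t / 2)) with hr
  have hr0 : 0 < r := Real.sqrt_pos.2 (by linarith)
  have hr2 : r ^ 2 = 2 * Real.sin (t / 2) := Real.sq_sqrt (by linarith)
  set p : ℂ := r * eF t with hp
  have hp2 : p ^ 2 = 1 - Complex.exp (Complex.I * t) := by
    rw [hp, mul_pow, ← Complex.ofReal_pow, hr2, ← eF_sq]; push_cast; ring
  have hpre : 0 < p.re := by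
    rw [hp, Complex.re_ofReal_mul]; exact mul_pos hr0 (eF_re h0.le h1)
  have hp2re : 0 ≤ (p ^ 2).re := by
    rw [hp2, Complex.sub_re, expI_re]; simp [Real.cos_le_one]
  have hq2re : 0 < (qF t ^ 2).re := by rw [qF_sq]; exact two_sub_re t
  obtain ⟨k1, k2⟩ := key_alg p (qF t) hpre (qF_re t) hp2re hq2re (by rw [hp2, qF_sq]; ring)
  have hw : wFn t = p ^ 2 + qF t ^ 2 := by rw [hp2, qF_sq, wFn]; ring
  have hw1 : wFn t ^ 2 - 1 = (2 * p * qF t) ^ 2 := by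
    rw [wFn, mul_pow, mul_pow, hp2, qF_sq]; ring
  have hroot : (wFn t ^ 2 - 1) ^ ((1 : ℂ) / 2) = 2 * p * qF t := by
    rw [hw1, one_div]; exact Complex.sq_cpow_two_inv k1
  have hphi : ((1 - phiFn t : ℝ)) = (wFn t * (2 * p * qF t) - (2 * p * qF t) ^ 2).re := by
    rw [phiFn, hroot, ← hw1]; simp; ring
  constructor
  · rw [hphi]
    have : wFn t * (2 * p * qF t) - (2 * p * qF t) ^ 2 =
      r * ((2 * eF t * qF t * wFn t) - r * ((2 * eF t * qF t) ^ 2)) := by rw [hp]; ring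
    rw [this, Complex.re_ofReal_mul, Complex.sub_re, Complex.re_ofReal_mul]
  · rw [hphi, hw]
    convert k2 using 2
    ring

def mF (s : ℝ) : ℝ := √(scR (s ^ 2 / 2))
def dF (s : ℝ) : ℝ := (2 * eF (s ^ 2) * qF (s ^ 2) * wFn (s ^ 2)).re -
  s * mF s * ((2 * eF (s ^ 2) * qF (s ^ 2)) ^ 2).re
def QF (s : ℝ) : ℝ := (mF s * dF s)⁻¹

lemma sq_le_pi {s : ℝ} (h0 : 0 ≤ s) (h1 : s ≤ √Real.pi) : s ^ 2 ≤ Real.pi := by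
  calc s ^ 2 ≤ (√Real.pi) ^ 2 := by gcongr
    _ = _ := Real.sq_sqrt Real.pi_pos.le

lemma mF_pos {s : ℝ} (h0 : 0 ≤ s) (h1 : s ≤ √Real.pi) : 0 < mF s := by
  apply Real.sqrt_pos.2
  apply scR_pos (by positivity)
  linarith [sq_le_pi h0 h1, Real.pi_pos]

lemma s_mF {s : ℝ} (h0 : 0 ≤ s) : s * mF s = √(2 * Real.sin (s ^ 2 / 2)) := by
  rw [mF, ← scR_mul, show 2 * (s ^ 2 / 2 * scR (s ^ 2 / 2)) = s ^ 2 * scR (s ^ 2 / 2) by ring,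
    Real.sqrt_mul (by positivity), Real.sqrt_sq h0]

lemma QF_eq {s : ℝ} (h0 : 0 < s) (h1 : s ≤ √Real.pi) :
    s * (mF s * dF s) = 1 - phiFn (s ^ 2) := by
  rw [(phi_eq (by positivity) (sq_le_pi h0.le h1)).1, ← s_mF h0.le, dF]; ring

lemma dF_pos {s : ℝ} (h0 : 0 ≤ s) (h1 : s ≤ √Real.pi) : 0 < dF s := by
  rcases h0.eq_or_lt with rfl | h
  · have hq : qF 0 = 1 := by simp [qF]; norm_num
    have hw : wFn 0 = 1 := by simp [wFn]; norm_num
    simp only [dF]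
    norm_num [hq, hw]
    exact eF_re le_rfl Real.pi_pos.le
  · have := (phi_eq (t := s ^ 2) (by positivity) (sq_le_pi h0 h1)).2
    rw [← QF_eq h h1, ← mul_assoc] at this
    exact pos_of_mul_pos_right this (mul_nonneg h0 (mF_pos h0 h1).le)

lemma QF_pos {s : ℝ} (h0 : 0 ≤ s) (h1 : s ≤ √Real.pi) : 0 < QF s :=
  inv_pos.2 (mul_pos (mF_pos h0 h1) (dF_pos h0 h1))

lemma QF_contDiffAt {s : ℝ} (h0 : 0 ≤ s) (h1 : s ≤ √Real.pi) : ContDiffAt ℝ 1 QF s := by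
  have hsq : ContDiff ℝ 1 (fun s : ℝ => s ^ 2) := by fun_prop
  have hsq2 : ContDiff ℝ 1 (fun s : ℝ => s ^ 2 / 2) := by fun_prop
  have hm : ContDiffAt ℝ 1 mF s :=
    ContDiffAt.sqrt (scR_contDiff.comp hsq2).contDiffAt (Real.sqrt_pos.1 (mF_pos h0 h1)).ne'
  have he := eF_contDiff.comp hsq
  have hq := qF_contDiff.comp hsq
  have hw := wFn_contDiff.comp hsq
  have ha : ContDiff ℝ 1 (fun s : ℝ => (2 * eF (s ^ 2) * qF (s ^ 2) * wFn (s ^ 2)).re) :=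
    Complex.reCLM.contDiff.comp (((contDiff_const.mul he).mul hq).mul hw)
  have hb : ContDiff ℝ 1 (fun s : ℝ => ((2 * eF (s ^ 2) * qF (s ^ 2)) ^ 2).re) :=
    Complex.reCLM.contDiff.comp (((contDiff_const.mul he).mul hq).pow 2)
  have hd : ContDiffAt ℝ 1 dF s := ha.contDiffAt.sub ((contDiffAt_id.mul hm).mul hb.contDiffAt)
  exact (hm.mul hd).inv (mul_pos (mF_pos h0 h1) (dF_pos h0 h1)).ne'

lemma gamma_eq (y : ℝ) : gammaFn y = 2 * ∫ s in (0:ℝ)..√Real.pi, QF s * Real.cos (y * s ^ 2) := by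
  have hb : 0 ≤ √Real.pi := Real.sqrt_nonneg _
  rw [gammaFn, intervalIntegral.integral_of_le Real.pi_pos.le, intervalIntegral.integral_of_le hb]
  have himg : (fun s : ℝ => s ^ 2) '' Set.Ioc 0 √Real.pi = Set.Ioc 0 Real.pi := by
    ext t
    constructor
    · rintro ⟨s, ⟨h0, h1⟩, rfl⟩
      exact ⟨by positivity, sq_le_pi h0.le h1⟩
    · rintro ⟨h0, h1⟩
      exact ⟨√t, ⟨Real.sqrt_pos.2 h0, Real.sqrt_le_sqrt h1⟩, Real.sq_sqrt h0.le⟩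
  have h := MeasureTheory.integral_image_eq_integral_abs_deriv_smul (s := Set.Ioc 0 √Real.pi)
    (f := fun s : ℝ => s ^ 2) (f' := fun s => 2 * s) measurableSet_Ioc
    (fun x _ => by simpa using (hasDerivAt_pow 2 x).hasDerivWithinAt)
    (fun a ha b hb h => by
      have := ha.1; have := hb.1
      exact (pow_left_inj₀ ha.1.le hb.1.le two_ne_zero).1 h)
    (fun t => Real.cos (y * t) / (1 - phiFn t))
  rw [himg] at h
  rw [h, ← MeasureTheory.integral_const_mul]
  apply MeasureTheory.setIntegral_congr_fun measurableSet_Ioc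
  rintro s ⟨h0, h1⟩
  have h2 := mF_pos h0.le h1
  have h3 := dF_pos h0.le h1
  simp only [smul_eq_mul]
  rw [← QF_eq h0 h1, abs_of_pos (by positivity), QF]
  field_simp

def F0 (v : ℝ) : ℝ := ∫ u in (0:ℝ)..v, Real.cos (u ^ 2)
def kF (u : ℝ) : ℝ := 3 * (1 - Real.cos (u ^ 2)) / (4 * u ^ 4)
def EF (v : ℝ) : ℝ := Real.sin (v ^ 2) / (2 * v) + (1 - Real.cos (v ^ 2)) / (4 * v ^ 3)

lemma kF_nonneg (u : ℝ) : 0 ≤ kF u := by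
  have := Real.cos_le_one (u ^ 2)
  exact div_nonneg (by linarith) (by positivity)

lemma kF_le (u : ℝ) : kF u ≤ 3 / 8 := by
  rcases eq_or_ne u 0 with rfl | h
  · norm_num [kF]
  · have := Real.one_sub_sq_div_two_le_cos (x := u ^ 2)
    rw [kF, div_le_div_iff₀ (by positivity) (by norm_num)]
    nlinarith

lemma kF_le' {u : ℝ} (h : 0 < u) : kF u ≤ 3 / 2 * u ^ (-4 : ℝ) := by
  have := Real.neg_one_le_cos (u ^ 2)
  rw [Real.rpow_neg h.le, kF, ← div_eq_mul_inv]
  norm_cast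
  rw [div_le_div_iff₀ (by positivity) (by positivity)]
  have : 0 < u ^ 4 := by positivity
  nlinarith

lemma kF_meas : Measurable kF := by unfold kF; fun_prop

open MeasureTheory in
lemma kF_integrable : IntegrableOn kF (Set.Ioi 0) := by
  rw [← Set.Ioc_union_Ioi_eq_Ioi zero_le_one]
  apply IntegrableOn.union
  · apply Measure.integrableOn_of_bounded (M := 3 / 8) (by simp) kF_meas.aestronglyMeasurable
    filter_upwards with u
    rw [Real.norm_of_nonneg (kF_nonneg u)]; exact kF_le u
  · have := (integrableOn_Ioi_rpow_of_lt (a := -4) (by norm_num) (c := 1) one_pos).const_mul (3 / 2)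
    refine Integrable.mono' this kF_meas.aestronglyMeasurable ?_
    filter_upwards [ae_restrict_mem measurableSet_Ioi] with u hu
    rw [Real.norm_of_nonneg (kF_nonneg u)]; exact kF_le' (lt_trans one_pos hu)

def KF : ℝ := ∫ u in Set.Ioi (0:ℝ), kF u

lemma kF_intervalIntegrable {v : ℝ} (hv : 0 ≤ v) : IntervalIntegrable kF MeasureTheory.volume 0 v :=
  (intervalIntegrable_iff_integrableOn_Ioc_of_le hv).2
    (kF_integrable.mono_set Set.Ioc_subset_Ioi_self)

lemma KF_pos : 0 < KF := by
  have h1 : 0 < ∫ u in (0:ℝ)..1, kF u := by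
    apply intervalIntegral.intervalIntegral_pos_of_pos_on (kF_intervalIntegrable zero_le_one) _ one_pos
    rintro u ⟨h0, h1⟩
    have : Real.cos (u ^ 2) < 1 := by
      have := Real.cos_lt_cos_of_nonneg_of_le_pi (x := 0) (y := u ^ 2) le_rfl
        (by nlinarith [Real.pi_gt_three]) (by positivity)
      simpa using this
    apply div_pos (by linarith) (by positivity)
  refine lt_of_lt_of_le h1 ?_
  rw [intervalIntegral.integral_of_le zero_le_one]
  apply MeasureTheory.setIntegral_mono_set kF_integrable
  · filter_upwards with u using kF_nonneg u
  · exact Set.Ioc_subset_Ioi_self.eventuallyLE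

lemma EF_bound (v : ℝ) : |EF v| ≤ 5 / 8 * |v| := by
  rcases eq_or_ne v 0 with rfl | h
  · simp [EF]
  · have hv := abs_pos.2 h
    have h1 : |Real.sin (v ^ 2)| ≤ v ^ 2 := by
      have := Real.abs_sin_le_abs (x := v ^ 2)
      rwa [abs_of_nonneg (sq_nonneg v)] at this
    have h2 := Real.one_sub_sq_div_two_le_cos (x := v ^ 2)
    have h3 := Real.cos_le_one (v ^ 2)
    have h4 : |1 - Real.cos (v ^ 2)| ≤ v ^ 4 / 2 := by
      rw [abs_of_nonneg (by linarith)]; nlinarith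
    rw [EF]
    refine (abs_add_le _ _).trans ?_
    rw [abs_div, abs_div, abs_mul, abs_mul, abs_pow]
    have e1 : |Real.sin (v ^ 2)| / (|2| * |v|) ≤ |v| / 2 := by
      rw [div_le_div_iff₀ (by positivity) (by norm_num), abs_of_pos (two_pos (α := ℝ))]
      have := sq_abs v
      nlinarith
    have e2 : |1 - Real.cos (v ^ 2)| / (|4| * |v| ^ 3) ≤ |v| / 8 := by
      rw [div_le_div_iff₀ (by positivity) (by norm_num), abs_of_pos (four_pos (α := ℝ))]
      have : v ^ 4 = |v| ^ 4 := by rw [← abs_pow, abs_of_nonneg (by positivity)]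
      rw [this] at h4
      nlinarith
    linarith

lemma EF_bound' {v : ℝ} (hv : 1 ≤ v) : |EF v| ≤ 1 / v := by
  have h1 : |Real.sin (v ^ 2)| ≤ 1 := Real.abs_sin_le_one _
  have h2 := Real.neg_one_le_cos (v ^ 2)
  have h3 := Real.cos_le_one (v ^ 2)
  have h4 : |1 - Real.cos (v ^ 2)| ≤ 2 := by
    rw [abs_of_nonneg (by linarith)]; linarith
  have hv0 : 0 < v := by linarith
  rw [EF]
  refine (abs_add_le _ _).trans ?_
  rw [abs_div, abs_div, abs_of_pos (show 0 < 2 * v by positivity), abs_of_pos (show 0 < 4 * v ^ 3 by positivity)]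
  have e1 : |Real.sin (v ^ 2)| / (2 * v) ≤ 1 / (2 * v) := by gcongr
  have e2 : |1 - Real.cos (v ^ 2)| / (4 * v ^ 3) ≤ 2 / (4 * v) := by
    gcongr; nlinarith [sq_nonneg v]
  have : 1 / v = 1 / (2 * v) + 2 / (4 * v) := by field_simp; norm_num
  linarith

lemma EF_deriv {v : ℝ} (hv : 0 < v) : HasDerivAt EF (Real.cos (v ^ 2) - kF v) v := by
  have hp : HasDerivAt (fun v : ℝ => v ^ 2) (2 * v) v := by simpa using hasDerivAt_pow 2 v
  have h1 := hp.sin.div ((hasDerivAt_id v).const_mul 2) (by simp; positivity)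
  have h2 := (hp.cos.const_sub 1).div ((hasDerivAt_pow 3 v).const_mul 4) (by positivity)
  convert! h1.add h2 using 1
  simp [kF]
  field_simp
  ring

lemma F0_eq {v : ℝ} (hv : 0 ≤ v) : F0 v = EF v + ∫ u in (0:ℝ)..v, kF u := by
  have hc : IntervalIntegrable (fun u : ℝ => Real.cos (u ^ 2)) MeasureTheory.volume 0 v :=
    (by fun_prop : Continuous (fun u : ℝ => Real.cos (u ^ 2))).intervalIntegrable _ _
  have hk := kF_intervalIntegrable hv
  have h := intervalIntegral.integral_eq_sub_of_hasDerivAt_of_le hv (f := EF)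
    (f' := fun v => Real.cos (v ^ 2) - kF v) ?_ (fun x hx => EF_deriv hx.1) (hc.sub hk)
  · rw [intervalIntegral.integral_sub hc hk] at h
    have h0 : EF 0 = 0 := by simp [EF]
    rw [F0]; linarith
  · rintro x ⟨h0, h1⟩
    rcases h0.eq_or_lt with rfl | h
    · apply ContinuousAt.continuousWithinAt
      have h0 : EF 0 = 0 := by simp [EF]
      rw [ContinuousAt, h0]
      apply squeeze_zero_norm (a := fun v => 5 / 8 * |v|) EF_bound
      have : Continuous (fun v : ℝ => 5 / 8 * |v|) := by fun_prop
      simpa using this.tendsto 0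
    · exact (EF_deriv h).continuousAt.continuousWithinAt

lemma F0_tendsto : Tendsto F0 atTop (nhds KF) := by
  have h1 : Tendsto EF atTop (nhds 0) := by
    apply squeeze_zero_norm' (a := fun v : ℝ => 1 / v)
    · filter_upwards [eventually_ge_atTop 1] with v hv using EF_bound' hv
    · simpa using tendsto_inv_atTop_zero (𝕜 := ℝ)
  have h2 : Tendsto (fun v => ∫ u in (0:ℝ)..v, kF u) atTop (nhds KF) :=
    MeasureTheory.intervalIntegral_tendsto_integral_Ioi 0 kF_integrable tendsto_id
  have h3 := h1.add h2
  rw [zero_add] at h3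
  refine h3.congr' ?_
  filter_upwards [eventually_ge_atTop 0] with v hv using (F0_eq hv).symm

lemma F0_deriv (v : ℝ) : HasDerivAt F0 (Real.cos (v ^ 2)) v := by
  have hc : Continuous (fun u : ℝ => Real.cos (u ^ 2)) := by fun_prop
  exact hc.integral_hasStrictDerivAt 0 v |>.hasDerivAt

lemma F0_continuous : Continuous F0 :=
  continuous_iff_continuousAt.2 fun v => (F0_deriv v).continuousAt

lemma F0_bounded : ∃ M, ∀ v, 0 ≤ v → |F0 v| ≤ M := by
  have h := F0_tendsto.norm.eventually (eventually_le_nhds (lt_add_one ‖KF‖))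
  obtain ⟨V, hV⟩ := eventually_atTop.1 h
  obtain ⟨C, hC⟩ := (isCompact_Icc (a := 0) (b := V)).exists_bound_of_continuousOn F0_continuous.continuousOn
  refine ⟨max C (‖KF‖ + 1), fun v hv => ?_⟩
  rcases le_total v V with h | h
  · exact (hC v ⟨hv, h⟩).trans (le_max_left _ _)
  · exact (hV v h).trans (le_max_right _ _)

lemma QF_deriv_cont : ContinuousOn (deriv QF) (Set.Icc 0 √Real.pi) := by
  intro s hs
  have h := (QF_contDiffAt hs.1 hs.2).fderiv_right (m := 0) (by simp)
  have h2 : ContinuousAt (fun s => fderiv ℝ QF s 1) s := h.continuousAt.clm_apply continuousAt_const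
  exact h2.continuousWithinAt

lemma gamma_ibp (l : ℝ) : l * gammaFn (l ^ 2) =
    2 * (QF √Real.pi * F0 (l * √Real.pi) - ∫ s in (0:ℝ)..√Real.pi, deriv QF s * F0 (l * s)) := by
  have hb : 0 ≤ √Real.pi := Real.sqrt_nonneg _
  have hc : Continuous (fun s : ℝ => Real.cos ((l * s) ^ 2) * l) := by fun_prop
  have h := intervalIntegral.integral_mul_deriv_eq_deriv_mul (a := 0) (b := √Real.pi)
    (u := QF) (u' := deriv QF) (v := fun s => F0 (l * s)) (v' := fun s => Real.cos ((l * s) ^ 2) * l)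
    (fun s hs => by
      rw [Set.uIcc_of_le hb] at hs
      exact ((QF_contDiffAt hs.1 hs.2).differentiableAt (by simp)).hasDerivAt)
    (fun s _ => by
      have h1 : HasDerivAt (fun s => l * s) l s := by simpa using (hasDerivAt_id s).const_mul l
      exact (F0_deriv (l * s)).comp s h1)
    (ContinuousOn.intervalIntegrable (by rw [Set.uIcc_of_le hb]; exact QF_deriv_cont))
    (hc.intervalIntegrable _ _)
  have h0 : F0 (l * 0) = 0 := by simp [F0]
  rw [h0, mul_zero, sub_zero] at h
  rw [gamma_eq, ← h, mul_left_comm, ← intervalIntegral.integral_const_mul]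
  congr 1
  apply intervalIntegral.integral_congr
  intro s _
  simp only
  rw [mul_pow]; ring

lemma gamma_asymp' : Tendsto (fun l : ℝ => l * gammaFn (l ^ 2)) atTop (nhds (2 * (QF 0 * KF))) := by
  have hb : 0 < √Real.pi := Real.sqrt_pos.2 Real.pi_pos
  obtain ⟨M, hM⟩ := F0_bounded
  have hint : IntervalIntegrable (deriv QF) MeasureTheory.volume 0 √Real.pi :=
    ContinuousOn.intervalIntegrable (by rw [Set.uIcc_of_le hb.le]; exact QF_deriv_cont)
  have h1 : Tendsto (fun l : ℝ => F0 (l * √Real.pi)) atTop (nhds KF) :=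
    F0_tendsto.comp (tendsto_id.atTop_mul_const hb)
  have h2 : Tendsto (fun l : ℝ => ∫ s in (0:ℝ)..√Real.pi, deriv QF s * F0 (l * s)) atTop
      (nhds (∫ s in (0:ℝ)..√Real.pi, deriv QF s * KF)) := by
    apply intervalIntegral.tendsto_integral_filter_of_dominated_convergence
      (fun s => |deriv QF s| * M)
    · filter_upwards with l
      refine MeasureTheory.AEStronglyMeasurable.mul ?_ ?_
      · exact (measurable_deriv QF).aestronglyMeasurable
      · exact (F0_continuous.comp (by fun_prop : Continuous fun s : ℝ => l * s)).aestronglyMeasurable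
    · filter_upwards [eventually_ge_atTop 0] with l hl
      filter_upwards with s hs
      rw [Set.uIoc_of_le hb.le] at hs
      rw [norm_mul]
      exact mul_le_mul_of_nonneg_left (hM _ (mul_nonneg hl hs.1.le)) (norm_nonneg _)
    · exact hint.abs.mul_const M
    · filter_upwards with s hs
      rw [Set.uIoc_of_le hb.le] at hs
      exact (F0_tendsto.comp (tendsto_id.atTop_mul_const hs.1)).const_mul _
  have h3 : ∫ s in (0:ℝ)..√Real.pi, deriv QF s = QF √Real.pi - QF 0 := by
    apply intervalIntegral.integral_deriv_eq_sub _ hint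
    intro s hs
    rw [Set.uIcc_of_le hb.le] at hs
    exact (QF_contDiffAt hs.1 hs.2).differentiableAt (by simp)
  rw [intervalIntegral.integral_mul_const, h3] at h2
  have h4 := ((h1.const_mul (QF √Real.pi)).sub h2).const_mul 2
  rw [show QF √Real.pi * KF - (QF √Real.pi - QF 0) * KF = QF 0 * KF by ring] at h4
  refine h4.congr' ?_
  filter_upwards with l using (gamma_ibp l).symm

lemma gamma_neg (y : ℝ) : gammaFn (-y) = gammaFn y := by simp [gammaFn]

lemma gamma_abs (y : ℝ) : gammaFn |y| = gammaFn y := by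
  rcases abs_choice y with h | h <;> rw [h]
  exact gamma_neg y

lemma gamma_asymp : Tendsto (fun y : ℝ => √y * gammaFn y) atTop (nhds (2 * (QF 0 * KF))) := by
  refine (gamma_asymp'.comp Real.tendsto_sqrt_atTop).congr' ?_
  filter_upwards [eventually_ge_atTop 0] with y hy
  simp [Real.sq_sqrt hy]

/-- The Martin kernel `K₀(x,y) = G₀(x,y)/G₀(0,y) = γ(y-x)/γ(y)` of the induced Markov
chain on the horizontal axis tends to `1` as `|y| → ∞`: the Martin boundary of the
induced chain is trivial. -/
theorem martin_boundary_induced_trivial (x : ℤ) :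
    Tendsto (fun y : ℤ => gammaFn ((y : ℝ) - (x : ℝ)) / gammaFn (y : ℝ))
      (Filter.comap (fun y : ℤ => |y|) Filter.atTop) (nhds 1) := by
  have hC : 2 * (QF 0 * KF) ≠ 0 :=
    (mul_pos two_pos (mul_pos (QF_pos le_rfl (Real.sqrt_nonneg _)) KF_pos)).ne'
  have hy : Tendsto (fun y : ℤ => |(y : ℝ)|) (Filter.comap (fun y : ℤ => |y|) Filter.atTop) atTop := by
    have := (tendsto_intCast_atTop_atTop (R := ℝ)).comp
      (tendsto_comap (f := fun y : ℤ => |y|) (x := atTop))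
    refine this.congr fun y => ?_
    simp
  have hyx : Tendsto (fun y : ℤ => |(y : ℝ) - x|) (Filter.comap (fun y : ℤ => |y|) Filter.atTop) atTop := by
    refine tendsto_atTop_mono (fun y => ?_) (tendsto_atTop_add_const_right _ (-|(x:ℝ)|) hy)
    linarith [abs_sub_abs_le_abs_sub (y : ℝ) x]
  have h1 := gamma_asymp.comp hy
  have h2 := gamma_asymp.comp hyx
  have h3 : Tendsto (fun y : ℤ => |(y : ℝ)| / |(y : ℝ) - x|)
      (Filter.comap (fun y : ℤ => |y|) Filter.atTop) (nhds 1) := by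
    have h0 : Tendsto (fun y : ℤ => |(x : ℝ)| / |(y : ℝ) - x|)
      (Filter.comap (fun y : ℤ => |y|) Filter.atTop) (nhds 0) := hyx.const_div_atTop _
    rw [tendsto_iff_norm_sub_tendsto_zero]
    refine squeeze_zero' (Eventually.of_forall fun y => norm_nonneg _) ?_ h0
    filter_upwards [hyx.eventually_gt_atTop 0] with y hy
    rw [div_sub_one hy.ne', norm_div, Real.norm_eq_abs, Real.norm_eq_abs, abs_abs]
    apply div_le_div_of_nonneg_right _ hy.le
    have := abs_abs_sub_abs_le (y : ℝ) (y - x)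
    simpa using this
  have h4 : Tendsto (fun y : ℤ => √(|(y : ℝ)| / |(y : ℝ) - x|))
      (Filter.comap (fun y : ℤ => |y|) Filter.atTop) (nhds 1) := by
    have := (Real.continuous_sqrt.tendsto 1).comp h3
    rwa [Real.sqrt_one] at this
  have h5 := (h2.div h1 hC).mul h4
  rw [div_self hC, one_mul] at h5
  refine h5.congr' ?_
  filter_upwards [hyx.eventually_gt_atTop 0, hy.eventually_gt_atTop 0] with y hy1 hy2
  simp only [Function.comp, Pi.div_apply, gamma_abs]
  rw [Real.sqrt_div hy2.le]
  have := Real.sqrt_pos.2 hy1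
  have := Real.sqrt_pos.2 hy2
  rcases eq_or_ne (gammaFn y) 0 with h | h
  · simp [h]
  · field_simp
end
end
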